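/- arXiv:1807.07057 — 3 statements merged into one kernel-verified Lean document; each statement's English description precedes it below -/
import Mathlib

section
/- Let T be a tight 3-tree with t edges such that t ≥ 20 and c(T) ≤ 2. Then ex₃(n, T) ≤ ((t−1)/3)·C(n,2) for every n; that is, every n-vertex 3-uniform hypergraph with more than ((t−1)/3)·C(n,2) edges contains a copy of T. -/
open Finset

variable {V : Type*}

/-- The number of edges of `G` containing the vertex set `D`. -/
def degree [DecidableEq V] (G : Finset (Finset V)) (D : Finset V) : ℕ :=
  (G.filter fun e => D ⊆ e).card

/-- The shadow of an `r`-graph `G`: all `(r-1)`-element sets contained in some edge. -/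
def hshadow [DecidableEq V] (G : Finset (Finset V)) (r : ℕ) : Finset (Finset V) :=
  G.biUnion fun e => e.powersetCard (r - 1)

/-- The default weight of an edge `e` of an `r`-graph `G`. -/
noncomputable def weight [DecidableEq V] (G : Finset (Finset V)) (r : ℕ) (e : Finset V) : ℝ :=
  ∑ D ∈ e.powersetCard (r - 1), (1 : ℝ) / (degree G D : ℝ)

/-- `e 0, e 1, …, e (t-1)` is a proper ordering of the edges of the tight `r`-tree `T`. -/
def IsTightTreeOrdering [DecidableEq V] (r : ℕ) (T : Finset (Finset V))
    (e : ℕ → Finset V) (t : ℕ) : Prop :=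
  T = (Finset.range t).image e ∧
  (∀ i < t, (e i).card = r) ∧
  ∀ i, 0 < i → i < t →
    ∃ v ∈ e i, (∀ j < i, v ∉ e j) ∧ ∃ j < i, (e i).erase v ⊆ e j

/-- `T` is a tight `r`-tree. -/
def IsTightTree [DecidableEq V] (r : ℕ) (T : Finset (Finset V)) : Prop :=
  ∃ e t, IsTightTreeOrdering r T e t

/-- A leaf of `T` is a vertex of degree one. -/
def IsLeaf [DecidableEq V] (T : Finset (Finset V)) (v : V) : Prop :=
  (T.filter fun g => v ∈ g).card = 1

/-- `T'` is a trunk of the tight `r`-tree `T`: in some proper ordering of the edges of `T`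
the edges of `T'` come first, and all vertices of `T` outside `T'` are leaves of `T`. -/
def IsTrunk [DecidableEq V] (r : ℕ) (T T' : Finset (Finset V)) : Prop :=
  ∃ e t t', t' ≤ t ∧ IsTightTreeOrdering r T e t ∧
    T' = (Finset.range t').image e ∧
    ∀ v ∈ T.biUnion id, v ∉ T'.biUnion id → IsLeaf T v

/-- `G` contains a copy of `T`: an injection of the vertex set of `T` into the vertices of `G`
mapping edges of `T` to edges of `G`. -/
def ContainsCopy {W : Type*} [DecidableEq V] [DecidableEq W]
    (G : Finset (Finset W)) (T : Finset (Finset V)) : Prop :=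
  ∃ f : V → W, Set.InjOn f ↑(T.biUnion id) ∧ ∀ g ∈ T, g.image f ∈ G

/-- Given a set `S = {a,b,c,d}`, `dprime G S x y` is the number of vertices `z ∉ S`
with `{x,y,z}` an edge of `G`. -/
def dprime [Fintype V] [DecidableEq V] (G : Finset (Finset V)) (S : Finset V) (x y : V) : ℕ :=
  (Finset.univ.filter fun z => z ∉ S ∧ ({x, y, z} : Finset V) ∈ G).card

/-- The minimum codegree over the pairs of vertices contained in the edge `e`. -/
noncomputable def dmin [DecidableEq V] (G : Finset (Finset V)) (e : Finset V) : ℕ :=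
  sInf {k | ∃ D ⊆ e, D.card = 2 ∧ degree G D = k}

/-- The neighbourhood `N_G(B)`: all vertices `z ∉ B` with `B ∪ {z}` an edge. -/
def nbr [Fintype V] [DecidableEq V] (G : Finset (Finset V)) (B : Finset V) : Finset V :=
  Finset.univ.filter fun z => z ∉ B ∧ insert z B ∈ G

/-- The five pairs of vertices covered by the two edges `{a, b, c}` and `{a, b, d}`. -/
def trunkPair {α : Type*} (a b c d : α) : Fin 5 → α × α :=
  ![(a, b), (a, c), (b, c), (a, d), (b, d)]

/-- The edges of `T` other than `{a, b, c}` and `{a, b, d}`. -/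
def outerEdges [DecidableEq V] (T : Finset (Finset V)) (a b c d : V) : Finset (Finset V) :=
  T \ {{a, b, c}, {a, b, d}}

/-- `{a, b, c}` and `{a, b, d}` form a trunk of `T`, where every further edge `g` consists of the
pair numbered `κ g` and of the leaf `ℓ g`. -/
structure IsTwoTrunk [DecidableEq V] (T : Finset (Finset V)) (a b c d : V)
    (ℓ : Finset V → V) (κ : Finset V → Fin 5) : Prop where
  nodup : [a, b, c, d].Nodup
  left_mem : {a, b, c} ∈ T
  right_mem : {a, b, d} ∈ T
  eq_insert : ∀ g ∈ outerEdges T a b c d,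
    g = {(trunkPair a b c d (κ g)).1, (trunkPair a b c d (κ g)).2, ℓ g}
  leaf_notMem : ∀ g ∈ outerEdges T a b c d, ℓ g ∉ ({a, b, c, d} : Finset V)
  leaf_injOn : Set.InjOn ℓ ↑(outerEdges T a b c d)

/-- A two-element subset of `{a, b, c}` or of `{a, b, d}` is one of the five trunk pairs. -/
lemma exists_trunkPair_eq [DecidableEq V] {a b c d : V} {s : Finset V} (hs : s.card = 2)
    (h : s ⊆ {a, b, c} ∨ s ⊆ {a, b, d}) :
    ∃ i, s = {(trunkPair a b c d i).1, (trunkPair a b c d i).2} := by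
  obtain ⟨x, y, hxy, rfl⟩ := Finset.card_eq_two.1 hs
  simp only [Finset.insert_subset_iff, Finset.singleton_subset_iff, Finset.mem_insert,
    Finset.mem_singleton] at h
  simp only [Fin.exists_fin_succ, trunkPair]
  rcases h with ⟨hx, hy⟩ | ⟨hx, hy⟩ <;> rcases hx with rfl | rfl | rfl <;>
    rcases hy with rfl | rfl | rfl <;> simp_all [Finset.pair_comm]

lemma IsLeaf.eq_of_mem [DecidableEq V] {T : Finset (Finset V)} {v : V} (h : IsLeaf T v)
    {g g' : Finset V} (hg : g ∈ T) (hg' : g' ∈ T) (hv : v ∈ g) (hv' : v ∈ g') : g = g' :=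
  Finset.card_le_one.1 h.le g (by simp [hg, hv]) g' (by simp [hg', hv'])

lemma IsTightTreeOrdering.injOn [DecidableEq V] {r t : ℕ} {T : Finset (Finset V)}
    {e : ℕ → Finset V} (h : IsTightTreeOrdering r T e t) : Set.InjOn e ↑(Finset.range t) := by
  have key : ∀ i j, i < t → j < i → e i ≠ e j := by
    intro i j hi hj hij
    obtain ⟨v, hv, hv', -⟩ := h.2.2 i (by omega) hi
    exact hv' j hj (hij ▸ hv)
  intro i hi j hj hij
  simp only [Finset.coe_range, Set.mem_Iio] at hi hj
  rcases lt_trichotomy i j with h' | h' | h'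
  · exact absurd hij.symm (key j i hj h')
  · exact h'
  · exact absurd hij (key i j hi h')

/-- A tight `3`-tree with at least two edges and a trunk of size at most two
has a trunk of size exactly two, in explicit form. -/
lemma exists_isTwoTrunk [DecidableEq V] {T : Finset (Finset V)} (hT2 : 2 ≤ T.card)
    (hc : ∃ T', IsTrunk 3 T T' ∧ T'.card ≤ 2) :
    ∃ a b c d ℓ κ, IsTwoTrunk T a b c d ℓ κ := by
  obtain ⟨T', ⟨e, t, t', htt', hord, rfl, hleaf⟩, hcard⟩ := hc
  have hinj := hord.injOn
  obtain ⟨hTe, hcard3, hnew⟩ := hord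
  have hTcard : T.card = t := by rw [hTe, Finset.card_image_of_injOn hinj, Finset.card_range]
  rw [Finset.card_image_of_injOn (hinj.mono (by simpa using htt')), Finset.card_range] at hcard
  have hmem : ∀ i < t, e i ∈ T := fun i hi => by
    rw [hTe]; exact Finset.mem_image_of_mem _ (by simpa using hi)
  have hleaf' : ∀ i < t, ∀ v ∈ e i, v ∉ e 0 → v ∉ e 1 → IsLeaf T v := by
    intro i hi v hv h0 h1
    refine hleaf v (Finset.mem_biUnion.2 ⟨e i, hmem i hi, hv⟩) ?_
    simp only [Finset.mem_biUnion, Finset.mem_image, Finset.mem_range, id, not_exists, not_and]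
    rintro _ ⟨j, hj, rfl⟩ hvj
    obtain rfl | rfl : j = 0 ∨ j = 1 := by omega
    exacts [h0 hvj, h1 hvj]
  have ht2 : 2 ≤ t := hTcard ▸ hT2
  obtain ⟨v₀, -⟩ : (e 0).Nonempty := Finset.card_pos.1 (by rw [hcard3 0 (by omega)]; omega)
  have : Nonempty V := ⟨v₀⟩
  choose! v hv hvnew j hj hjsub using hnew
  have hsub : ∀ i < t, 2 ≤ i → (e i).erase (v i) ⊆ e 0 ∨ (e i).erase (v i) ⊆ e 1 := by
    intro i
    induction i using Nat.strong_induction_on with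
    | _ i ih =>
    intro hi h2
    have hji := hj i (by omega) hi
    have hs := hjsub i (by omega) hi
    by_cases hj2 : j i < 2
    · obtain h | h : j i = 0 ∨ j i = 1 := by omega
      · exact Or.inl (h ▸ hs)
      · exact Or.inr (h ▸ hs)
    · have hjt : j i < t := by omega
      have hvj := hvnew (j i) (by omega) hjt
      have hlf := hleaf' (j i) hjt _ (hv _ (by omega) hjt) (hvj 0 (by omega)) (hvj 1 (by omega))
      have hnot : v (j i) ∉ (e i).erase (v i) := fun hmem' => by
        have := hlf.eq_of_mem (hmem i hi) (hmem (j i) hjt) (Finset.mem_of_mem_erase hmem')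
          (hv _ (by omega) hjt)
        exact hvnew i (by omega) hi (j i) hji (this ▸ hv i (by omega) hi)
      have hsub' : (e i).erase (v i) ⊆ (e (j i)).erase (v (j i)) := fun x hx =>
        Finset.mem_erase.2 ⟨fun hxv => hnot (hxv ▸ hx), hs hx⟩
      exact (ih (j i) hji hjt (by omega)).imp hsub'.trans hsub'.trans
  set d := v 1
  have hd : d ∈ e 1 := hv 1 (by omega) (by omega)
  have hd0 : d ∉ e 0 := hvnew 1 (by omega) (by omega) 0 (by omega)
  have h10 : (e 1).erase d ⊆ e 0 := by
    have hj1 : j 1 = 0 := by have := hj 1 (by omega) (by omega); omega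
    have := hjsub 1 (by omega) (by omega)
    rwa [hj1] at this
  have h1card : ((e 1).erase d).card = 2 := by
    rw [Finset.card_erase_of_mem hd, hcard3 1 (by omega)]
  obtain ⟨a, b, hab, hab1⟩ := Finset.card_eq_two.1 h1card
  have h0card := hcard3 0 (by omega)
  obtain ⟨c, hc⟩ : ∃ c, e 0 \ {a, b} = {c} := by
    rw [← Finset.card_eq_one, Finset.card_sdiff_of_subset (hab1 ▸ h10), h0card,
      Finset.card_pair hab]
  have he1 : e 1 = {a, b, d} := by
    rw [← Finset.insert_erase hd, hab1]; ext x; simp; tauto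
  have he0 : e 0 = {a, b, c} := by
    rw [← Finset.sdiff_union_of_subset (hab1 ▸ h10 : {a, b} ⊆ e 0), hc]; ext x; simp; tauto
  have hcab : c ∉ ({a, b} : Finset V) := (Finset.mem_sdiff.1 (hc ▸ Finset.mem_singleton_self c)).2
  have hidx : ∀ g ∈ outerEdges T a b c d, ∃ i < t, 2 ≤ i ∧ e i = g := by
    intro g hg
    simp only [outerEdges, Finset.mem_sdiff, Finset.mem_insert, Finset.mem_singleton, not_or] at hg
    obtain ⟨i, hi, rfl⟩ := Finset.mem_image.1 (hTe ▸ hg.1)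
    refine ⟨i, by simpa using hi, ?_, rfl⟩
    by_contra h
    obtain rfl | rfl : i = 0 ∨ i = 1 := by omega
    exacts [hg.2.1 he0, hg.2.2 he1]
  have hform : ∀ g : Finset V, ∃ (x : V) (k : Fin 5), g ∈ outerEdges T a b c d →
      g = {(trunkPair a b c d k).1, (trunkPair a b c d k).2, x} ∧
      x ∉ ({a, b, c, d} : Finset V) ∧ IsLeaf T x := by
    intro g
    by_cases hg : g ∈ outerEdges T a b c d
    · obtain ⟨i, hi, h2, rfl⟩ := hidx g hg
      have hvi := hv i (by omega) hi
      have hn := hvnew i (by omega) hi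
      obtain ⟨k, hk⟩ := exists_trunkPair_eq (s := (e i).erase (v i)) (a := a) (b := b) (c := c)
        (d := d) (by rw [Finset.card_erase_of_mem hvi, hcard3 i hi])
        (by rw [← he0, ← he1]; exact hsub i hi h2)
      refine ⟨v i, k, fun _ => ⟨?_, ?_, hleaf' i hi _ hvi (hn 0 (by omega)) (hn 1 (by omega))⟩⟩
      · rw [← Finset.insert_erase hvi, hk]; ext x; simp; tauto
      · have h0 := hn 0 (by omega)
        have h1 := hn 1 (by omega)
        rw [he0] at h0; rw [he1] at h1
        simp only [Finset.mem_insert, Finset.mem_singleton] at h0 h1 ⊢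
        tauto
    · exact ⟨a, 0, fun h => absurd h hg⟩
  choose ℓ κ hℓκ using hform
  refine ⟨a, b, c, d, ℓ, κ, ?_, he0 ▸ hmem 0 (by omega), he1 ▸ hmem 1 (by omega),
    fun g hg => (hℓκ g hg).1, fun g hg => (hℓκ g hg).2.1, ?_⟩
  · rw [he0] at hd0
    simp only [Finset.mem_insert, Finset.mem_singleton] at hcab hd0
    simp only [List.nodup_cons, List.mem_cons, List.not_mem_nil, or_false, not_or]
    tauto
  · intro g hg g' hg' h
    have hmemℓ : ∀ g ∈ outerEdges T a b c d, ℓ g ∈ g := fun g hg =>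
      (Finset.ext_iff.1 (hℓκ g hg).1 (ℓ g)).2 (by simp)
    exact (hℓκ g hg).2.2.eq_of_mem (Finset.mem_sdiff.1 hg).1 (Finset.mem_sdiff.1 hg').1
      (hmemℓ g hg) (h ▸ hmemℓ g' hg')

/-- The number of leaves of the two-trunk that are attached to the pair numbered `i`. -/
def demand [DecidableEq V] (T : Finset (Finset V)) (a b c d : V) (κ : Finset V → Fin 5)
    (i : Fin 5) : ℕ :=
  ((outerEdges T a b c d).filter fun g => κ g = i).card

/-- Supplies `N i` suffice for the demands `p i` even if the underlying sets are nested. -/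
def Fits (p N : Fin 5 → ℕ) : Prop :=
  ∀ i, (∑ j, if N j ≤ N i then p j else 0) ≤ N i

lemma IsTwoTrunk.sum_demand [DecidableEq V] {T : Finset (Finset V)} {a b c d : V}
    {ℓ : Finset V → V} {κ : Finset V → Fin 5} (h : IsTwoTrunk T a b c d ℓ κ) :
    ∑ i, demand T a b c d κ i + 2 = T.card := by
  have hne : ({a, b, c} : Finset V) ≠ {a, b, d} := by
    intro heq
    have hn := h.nodup
    have : c ∈ ({a, b, d} : Finset V) := heq ▸ (by simp)
    simp only [List.nodup_cons, List.mem_cons, List.not_mem_nil, or_false, not_or] at hn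
    simp only [Finset.mem_insert, Finset.mem_singleton] at this
    tauto
  have hsub : ({{a, b, c}, {a, b, d}} : Finset (Finset V)) ⊆ T := by
    simp [Finset.insert_subset_iff, h.left_mem, h.right_mem]
  have h1 := Finset.card_sdiff_add_card_eq_card hsub
  rw [Finset.card_pair hne] at h1
  rw [← h1, Finset.card_eq_sum_card_fiberwise (f := κ) (t := Finset.univ) (by simp)]
  rfl

/-- Leaves with nested supplies can be chosen simultaneously, by Hall's theorem. -/
lemma exists_injective_of_fits {ι W : Type*} [Fintype ι] [DecidableEq W]
    (κ : ι → Fin 5) (A : Fin 5 → Finset W) (N : Fin 5 → ℕ) (hN : ∀ i, N i ≤ (A i).card)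
    (hfit : Fits (fun i => (Finset.univ.filter fun x => κ x = i).card) N) :
    ∃ f : ι → W, Function.Injective f ∧ ∀ x, f x ∈ A (κ x) := by
  rw [← Finset.all_card_le_biUnion_card_iff_exists_injective (fun x => A (κ x))]
  intro s
  obtain rfl | hs := s.eq_empty_or_nonempty
  · simp
  obtain ⟨x, hx, hmax⟩ := s.exists_max_image (fun x => N (κ x)) hs
  calc s.card ≤ ((Finset.univ : Finset ι).filter fun y => N (κ y) ≤ N (κ x)).card :=
        Finset.card_le_card fun y hy => by simpa using hmax y hy
    _ = ∑ j, if N j ≤ N (κ x) then (Finset.univ.filter fun y => κ y = j).card else 0 := by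
        rw [Finset.card_eq_sum_card_fiberwise (f := κ) (t := Finset.univ) (by simp)]
        refine Finset.sum_congr rfl fun j _ => ?_
        split_ifs with hj
        · congr 1; ext y; simp; rintro rfl; exact hj
        · rw [Finset.card_eq_zero, Finset.filter_eq_empty_iff]
          rintro y hy rfl
          exact hj (by simpa using hy)
    _ ≤ N (κ x) := hfit (κ x)
    _ ≤ (A (κ x)).card := hN _
    _ ≤ _ := Finset.card_le_card (Finset.subset_biUnion_of_mem (fun x => A (κ x)) hx)

/-- A two-trunk together with its leaves embeds greedily over two edges `{a', b', c'}` and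
`{a', b', d'}` whose pairs have large enough codegrees. -/
lemma IsTwoTrunk.containsCopy [DecidableEq V] {W : Type*} [Fintype W] [DecidableEq W]
    {T : Finset (Finset V)} {a b c d : V} {ℓ : Finset V → V} {κ : Finset V → Fin 5}
    (h : IsTwoTrunk T a b c d ℓ κ) {G : Finset (Finset W)} {a' b' c' d' : W}
    (hnd : [a', b', c', d'].Nodup) (hc : {a', b', c'} ∈ G) (hd : {a', b', d'} ∈ G)
    (N : Fin 5 → ℕ)
    (hN : ∀ i, N i ≤ dprime G {a', b', c', d'} (trunkPair a' b' c' d' i).1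
      (trunkPair a' b' c' d' i).2)
    (hfit : Fits (demand T a b c d κ) N) : ContainsCopy G T := by
  obtain ⟨f, hf, hfA⟩ := exists_injective_of_fits
    (ι := {g // g ∈ outerEdges T a b c d}) (fun g => κ g)
    (fun i => Finset.univ.filter fun z => z ∉ ({a', b', c', d'} : Finset W) ∧
      ({(trunkPair a' b' c' d' i).1, (trunkPair a' b' c' d' i).2, z} : Finset W) ∈ G) N hN
    (by
      convert hfit using 2 with i
      rw [demand, ← Finset.card_map (Function.Embedding.subtype _)]
      congr 1
      ext g
      simp only [Finset.mem_map, Finset.mem_filter, Finset.mem_univ, true_and,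
        Function.Embedding.subtype_apply, Subtype.exists, exists_and_left, exists_prop,
        exists_eq_right_right]
      tauto)
  have hnd0 := h.nodup
  simp only [List.nodup_cons, List.mem_cons, List.not_mem_nil, or_false, not_or, not_false_iff,
    List.nodup_nil, and_true] at hnd hnd0
  obtain ⟨⟨_, _, _⟩, ⟨_, _⟩, _⟩ := hnd
  have hℓ : Function.Injective fun g : {g // g ∈ outerEdges T a b c d} => ℓ g :=
    fun g g' hgg => Subtype.ext (h.leaf_injOn g.2 g'.2 hgg)
  obtain ⟨F, hFa, hFb, hFc, hFd, hFℓ⟩ : ∃ F : V → W, F a = a' ∧ F b = b' ∧ F c = c' ∧ F d = d' ∧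
      ∀ g : {g // g ∈ outerEdges T a b c d}, F (ℓ g) = f g := by
    have hout : ∀ v ∈ ({a, b, c, d} : Finset V),
        ¬ ∃ g : {g // g ∈ outerEdges T a b c d}, ℓ g = v := by
      rintro v hv ⟨g, rfl⟩
      exact h.leaf_notMem g g.2 hv
    refine ⟨Function.extend (fun g : {g // g ∈ outerEdges T a b c d} => ℓ g) f
      fun v => if v = a then a' else if v = b then b' else if v = c then c' else d',
      ?_, ?_, ?_, ?_, fun g => hℓ.extend_apply _ _ g⟩
    · rw [Function.extend_apply' _ _ _ (hout a (by simp))]; simp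
    · rw [Function.extend_apply' _ _ _ (hout b (by simp))]; simp [Ne.symm hnd0.1.1]
    · rw [Function.extend_apply' _ _ _ (hout c (by simp))]
      simp [Ne.symm hnd0.1.2.1, Ne.symm hnd0.2.1.1]
    · rw [Function.extend_apply' _ _ _ (hout d (by simp))]
      simp [Ne.symm hnd0.1.2.2, Ne.symm hnd0.2.1.2, Ne.symm hnd0.2.2]
  have hFpair : ∀ i, F (trunkPair a b c d i).1 = (trunkPair a' b' c' d' i).1 ∧
      F (trunkPair a b c d i).2 = (trunkPair a' b' c' d' i).2 := by
    simp [Fin.forall_fin_succ, trunkPair, hFa, hFb, hFc, hFd]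
  have hfS : ∀ g, f g ∉ ({a', b', c', d'} : Finset W) := fun g => by
    have := hfA g
    simp only [Finset.mem_filter] at this
    exact this.2.1
  have hcover : ∀ v ∈ T.biUnion id, v ∈ ({a, b, c, d} : Finset V) ∨
      ∃ g : {g // g ∈ outerEdges T a b c d}, ℓ g = v := by
    intro v hv
    obtain ⟨g, hg, hvg⟩ := Finset.mem_biUnion.1 hv
    by_cases hg' : g ∈ outerEdges T a b c d
    · have hvg' := (Finset.ext_iff.1 (h.eq_insert g hg') v).1 hvg
      have hpair : ∀ i, (trunkPair a b c d i).1 ∈ ({a, b, c, d} : Finset V) ∧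
          (trunkPair a b c d i).2 ∈ ({a, b, c, d} : Finset V) := by
        simp [Fin.forall_fin_succ, trunkPair]
      simp only [Finset.mem_insert (b := (trunkPair a b c d (κ g)).1),
        Finset.mem_insert (b := (trunkPair a b c d (κ g)).2), Finset.mem_singleton] at hvg'
      rcases hvg' with h1 | h1 | h1
      · exact Or.inl (h1 ▸ (hpair _).1)
      · exact Or.inl (h1 ▸ (hpair _).2)
      · exact Or.inr ⟨⟨g, hg'⟩, h1.symm⟩
    · left
      simp only [outerEdges, Finset.mem_sdiff, hg, true_and, not_not, Finset.mem_insert,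
        Finset.mem_singleton] at hg'
      rcases hg' with rfl | rfl <;> simp only [id, Finset.mem_insert, Finset.mem_singleton] at hvg ⊢
        <;> tauto
  have hFS : ∀ v ∈ ({a, b, c, d} : Finset V), F v ∈ ({a', b', c', d'} : Finset W) := by
    simp [hFa, hFb, hFc, hFd]
  refine ⟨F, ?_, ?_⟩
  · intro v hv w hw hvw
    rcases hcover v hv with h1 | ⟨g, rfl⟩ <;> rcases hcover w hw with h2 | ⟨g', rfl⟩
    · simp only [Finset.mem_insert, Finset.mem_singleton] at h1 h2
      rcases h1 with rfl | rfl | rfl | rfl <;> rcases h2 with rfl | rfl | rfl | rfl <;>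
        simp only [hFa, hFb, hFc, hFd] at hvw <;>
        first | rfl | exact absurd hvw ‹_› | exact absurd hvw.symm ‹_›
    · exact absurd (hvw ▸ hFS v h1) (hFℓ g' ▸ hfS g')
    · exact absurd (hvw.symm ▸ hFS w h2) (hFℓ g ▸ hfS g)
    · rw [hFℓ, hFℓ] at hvw
      rw [hf hvw]
  · intro g hg
    by_cases hg' : g ∈ outerEdges T a b c d
    · have := hfA ⟨g, hg'⟩
      rw [h.eq_insert g hg', Finset.image_insert, Finset.image_insert, Finset.image_singleton,
        (hFpair _).1, (hFpair _).2, hFℓ ⟨g, hg'⟩]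
      simp only [Finset.mem_filter] at this
      exact this.2.2
    · simp only [outerEdges, Finset.mem_sdiff, hg, true_and, not_not, Finset.mem_insert,
        Finset.mem_singleton] at hg'
      rcases hg' with rfl | rfl
      · simpa [Finset.image_insert, hFa, hFb, hFc] using hc
      · simpa [Finset.image_insert, hFa, hFb, hFd] using hd

/-- The vertices forming an edge of `G` together with `x` and `y`. -/
def third [Fintype V] [DecidableEq V] (G : Finset (Finset V)) (x y : V) : Finset V :=
  Finset.univ.filter fun z => {x, y, z} ∈ G

/-- The ordered pairs of distinct vertices covered by an edge of `G`. -/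
def coveredPairs [DecidableEq V] (G : Finset (Finset V)) : Finset (V × V) :=
  G.biUnion Finset.offDiag

lemma mem_coveredPairs [DecidableEq V] {G : Finset (Finset V)} {x y : V} :
    (x, y) ∈ coveredPairs G ↔ x ≠ y ∧ ∃ g ∈ G, x ∈ g ∧ y ∈ g := by
  simp only [coveredPairs, Finset.mem_biUnion, Finset.mem_offDiag]
  tauto

section third

variable [Fintype V] [DecidableEq V] {G : Finset (Finset V)} {x y z : V}

lemma mem_third : z ∈ third G x y ↔ {x, y, z} ∈ G := by simp [third]

lemma third_comm (G : Finset (Finset V)) (x y : V) : third G x y = third G y x := by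
  ext z; rw [mem_third, mem_third, Finset.insert_comm]

lemma mem_third_rotate : z ∈ third G x y ↔ x ∈ third G y z := by
  rw [mem_third, mem_third]
  have : ({x, y, z} : Finset V) = {y, z, x} := by ext; simp; tauto
  rw [this]

lemma mem_third_swap : z ∈ third G x y ↔ y ∈ third G x z := by
  rw [mem_third, mem_third, Finset.pair_comm]

lemma nodup_of_mem_third (hG : ∀ g ∈ G, g.card = 3) (hz : z ∈ third G x y) :
    x ≠ y ∧ x ≠ z ∧ y ≠ z := by
  have h := hG _ (mem_third.1 hz)
  have h2 : ∀ u v : V, ({u, v} : Finset V).card ≤ 2 := fun u v => Finset.card_le_two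
  refine ⟨?_, ?_, ?_⟩ <;> rintro rfl
  · have := h2 x z
    simp_all
  · have := h2 y x
    rw [Finset.insert_eq_of_mem (by simp)] at h
    omega
  · have := h2 x y
    simp_all

lemma card_third (hG : ∀ g ∈ G, g.card = 3) (hxy : x ≠ y) :
    (third G x y).card = (G.filter fun g => x ∈ g ∧ y ∈ g).card := by
  refine Finset.card_nbij (fun z => {x, y, z}) ?_ ?_ ?_
  · intro z hz
    simpa using mem_third.1 hz
  · intro z hz w hw hzw
    have hz' := nodup_of_mem_third hG hz
    have : z ∈ ({x, y, w} : Finset V) := (Finset.ext_iff.1 hzw z).1 (by simp)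
    simp only [Finset.mem_insert, Finset.mem_singleton] at this
    tauto
  · intro g hg
    simp only [Finset.coe_filter, Set.mem_ofPred_eq] at hg
    obtain ⟨hgG, hx, hy⟩ := hg
    have hsub : ({x, y} : Finset V) ⊆ g := by simp [Finset.insert_subset_iff, hx, hy]
    obtain ⟨z, hz⟩ : ∃ z, g \ {x, y} = {z} := by
      rw [← Finset.card_eq_one, Finset.card_sdiff_of_subset hsub, hG g hgG, Finset.card_pair hxy]
    have hgz : {x, y, z} = g := by
      rw [← Finset.sdiff_union_of_subset hsub, hz]; ext w; simp; tauto
    exact ⟨z, by simpa [mem_third, hgz] using hgG, hgz⟩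

lemma mem_coveredPairs_iff_third (hG : ∀ g ∈ G, g.card = 3) :
    (x, y) ∈ coveredPairs G ↔ (third G x y).Nonempty := by
  rw [mem_coveredPairs]
  constructor
  · rintro ⟨hxy, g, hg, hx, hy⟩
    rw [← Finset.card_pos, card_third hG hxy, Finset.card_pos]
    exact ⟨g, by simp [hg, hx, hy]⟩
  · rintro ⟨z, hz⟩
    exact ⟨(nodup_of_mem_third hG hz).1, _, mem_third.1 hz, by simp, by simp⟩

lemma sum_card_third (hG : ∀ g ∈ G, g.card = 3) :
    ∑ p : V × V, (third G p.1 p.2).card = 6 * G.card := by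
  have h : ∑ g ∈ G, g.offDiag.card = 6 * G.card := by
    rw [Finset.sum_const_nat (m := 6) (fun g hg => by rw [Finset.offDiag_card, hG g hg]), mul_comm]
  have h2 := Finset.sum_card_bipartiteAbove_eq_sum_card_bipartiteBelow
    (s := (Finset.univ : Finset (V × V))) (t := G) (fun p g => p ∈ g.offDiag)
  simp only [Finset.bipartiteAbove, Finset.bipartiteBelow, Finset.filter_univ_mem] at h2
  rw [← h, ← h2]
  refine Finset.sum_congr rfl fun p _ => ?_
  by_cases hp : p.1 = p.2
  · have h0 : third G p.1 p.2 = ∅ := Finset.eq_empty_of_forall_notMem fun z hz =>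
      (nodup_of_mem_third hG hz).1 hp
    rw [h0]
    simp [hp]
  · simp [card_third hG hp, hp]

/-- A dense `3`-graph contains a dense `3`-graph in which all positive codegrees are large. -/
lemma exists_dense_subgraph {m : ℕ} (hG : ∀ g ∈ G, g.card = 3)
    (h : m * (coveredPairs G).card < 6 * G.card) :
    ∃ H ⊆ G, m * (coveredPairs H).card < 6 * H.card ∧
      ∀ x y, (third H x y).Nonempty → m < 3 * (third H x y).card := by
  obtain ⟨H, hH, hmin⟩ := Finset.exists_min_image
    (G.powerset.filter fun H => m * (coveredPairs H).card < 6 * H.card) Finset.card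
    ⟨G, by simpa using h⟩
  simp only [Finset.mem_filter, Finset.mem_powerset] at hH hmin
  refine ⟨H, hH.1, hH.2, fun x y hxy => ?_⟩
  have hH3 : ∀ g ∈ H, g.card = 3 := fun g hg => hG g (hH.1 hg)
  obtain ⟨z, hz⟩ := hxy
  have hne := (nodup_of_mem_third hH3 hz).1
  have hpos : 0 < (third H x y).card := Finset.card_pos.2 ⟨z, hz⟩
  by_contra! hk
  set H' := H.filter fun g => ¬ (x ∈ g ∧ y ∈ g)
  have hcard : (third H x y).card + H'.card = H.card := by
    rw [card_third hH3 hne, Finset.card_filter_add_card_filter_not]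
  have hcov : (coveredPairs H').card + 2 ≤ (coveredPairs H).card := by
    have hxy : (x, y) ≠ (y, x) := by simp [hne]
    rw [← Finset.card_pair hxy, ← Finset.card_union_of_disjoint]
    · refine Finset.card_le_card (Finset.union_subset ?_ ?_)
      · exact Finset.biUnion_subset_biUnion_of_subset_left _ (Finset.filter_subset _ _)
      · have := mem_third.1 hz
        simp only [Finset.insert_subset_iff, Finset.singleton_subset_iff, mem_coveredPairs]
        exact ⟨⟨hne, _, this, by simp, by simp⟩, hne.symm, _, this, by simp, by simp⟩
    · rw [Finset.disjoint_right]
      simp only [Finset.mem_insert, Finset.mem_singleton]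
      rintro p (rfl | rfl) <;> rw [mem_coveredPairs] <;> rintro ⟨-, g, hg, h1, h2⟩ <;>
        exact (Finset.mem_filter.1 hg).2 (by tauto)
  have hmul := Nat.mul_le_mul_left m hcov
  have := hmin H' ⟨(Finset.filter_subset _ _).trans hH.1, by
    rw [Nat.mul_add] at hmul; omega⟩
  omega

end third

section discharging

variable [Fintype V] [DecidableEq V] {G : Finset (Finset V)} {m : ℕ} {x y z : V}

/-- The ratio of `m` and the codegree of `x` and `y`. -/
noncomputable def ratio (G : Finset (Finset V)) (m : ℕ) (x y : V) : ℝ :=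
  m / (third G x y).card

/-- The excess of the edge `{x, y, z}`: the sum of the ratios of its three pairs, minus three. -/
noncomputable def excess (G : Finset (Finset V)) (m : ℕ) (x y z : V) : ℝ :=
  ratio G m x y + ratio G m y z + ratio G m z x - 3

lemma ratio_comm (G : Finset (Finset V)) (m : ℕ) (x y : V) : ratio G m x y = ratio G m y x := by
  rw [ratio, ratio, third_comm]

lemma excess_rotate (G : Finset (Finset V)) (m : ℕ) (x y z : V) :
    excess G m y z x = excess G m x y z := by
  rw [excess, excess]; ring

lemma excess_swap (G : Finset (Finset V)) (m : ℕ) (x y z : V) :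
    excess G m y x z = excess G m x y z := by
  rw [excess, excess, ratio_comm G m y x, ratio_comm G m x z, ratio_comm G m z y]; ring

/-- A function on the ordered edges and its rotation have the same sum. -/
lemma sum_third_rotate (G : Finset (Finset V)) (f : V → V → V → ℝ) :
    ∑ p : V × V, ∑ z ∈ third G p.1 p.2, f p.2 z p.1 = ∑ p : V × V, ∑ z ∈ third G p.1 p.2,
      f p.1 p.2 z := by
  rw [Finset.sum_sigma', Finset.sum_sigma']
  refine Finset.sum_bij' (fun t _ => ⟨(t.1.2, t.2), t.1.1⟩) (fun t _ => ⟨(t.2, t.1.1), t.1.2⟩)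
    ?_ ?_ ?_ ?_ ?_
  · rintro ⟨⟨x, y⟩, z⟩ h
    simpa [mem_third_rotate (x := x)] using h
  · rintro ⟨⟨x, y⟩, z⟩ h
    simpa [mem_third_rotate (x := z)] using h
  all_goals simp

lemma sum_ratio (hG : ∀ g ∈ G, g.card = 3) (m : ℕ) :
    ∑ p : V × V, ∑ _z ∈ third G p.1 p.2, ratio G m p.1 p.2 = m * (coveredPairs G).card := by
  have h : ∀ p : V × V, ∑ _z ∈ third G p.1 p.2, ratio G m p.1 p.2 =
      if p ∈ coveredPairs G then (m : ℝ) else 0 := by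
    rintro ⟨x, y⟩
    rw [Finset.sum_const, nsmul_eq_mul, ratio]
    split_ifs with h <;> rw [mem_coveredPairs_iff_third hG] at h
    · have : ((third G x y).card : ℝ) ≠ 0 := by simpa [Finset.nonempty_iff_ne_empty] using h
      field_simp
    · simp [Finset.not_nonempty_iff_eq_empty.1 h]
  simp [h, mul_comm]

lemma sum_excess (hG : ∀ g ∈ G, g.card = 3) (m : ℕ) :
    ∑ p : V × V, ∑ z ∈ third G p.1 p.2, excess G m p.1 p.2 z =
      3 * (m * (coveredPairs G).card - 6 * G.card) := by
  have h1 := sum_ratio hG m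
  have h2 := sum_third_rotate G fun x y _ => ratio G m x y
  have h3 := sum_third_rotate G fun _ y z => ratio G m y z
  have h4 : ∑ p : V × V, ∑ _z ∈ third G p.1 p.2, (3 : ℝ) = 3 * (6 * G.card) := by
    have : (∑ p : V × V, ((third G p.1 p.2).card : ℝ)) = 6 * G.card := by
      exact_mod_cast sum_card_third hG
    simp only [Finset.sum_const, nsmul_eq_mul, ← Finset.sum_mul, this]
    ring
  simp only [excess, Finset.sum_add_distrib, Finset.sum_sub_distrib, h1, h2, h3, h4]
  ring

/-- If every edge has a rotation satisfying `C`, then on some pair the negative excesses of the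
edges satisfying `C` outweigh a third of the positive excesses. -/
lemma exists_sum_charge_neg (hG : ∀ g ∈ G, g.card = 3)
    (h : m * (coveredPairs G).card < 6 * G.card) (C : V → V → V → Prop)
    (hC : ∀ x y z, z ∈ third G x y → C x y z ∨ C y z x ∨ C z x y) [∀ x y z, Decidable (C x y z)] :
    ∃ x y, ∑ z ∈ third G x y, (if 0 ≤ excess G m x y z then excess G m x y z / 3 else
      if C x y z then excess G m x y z else 0) < 0 := by
  set ch : V → V → V → ℝ := fun x y z => if 0 ≤ excess G m x y z then excess G m x y z / 3 else
      if C x y z then excess G m x y z else 0 with hch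
  have h1 := sum_third_rotate G ch
  have h2 := sum_third_rotate G fun x y z => ch y z x
  have h3 : ∑ p : V × V, ∑ z ∈ third G p.1 p.2,
      (ch p.1 p.2 z + ch p.2 z p.1 + ch z p.1 p.2) ≤
      ∑ p : V × V, ∑ z ∈ third G p.1 p.2, excess G m p.1 p.2 z := by
    refine Finset.sum_le_sum fun p _ => Finset.sum_le_sum fun z hz => ?_
    have hr := excess_rotate G m p.1 p.2 z
    have hr' := excess_rotate G m p.2 z p.1
    simp only [hch, hr', hr]
    have := hC _ _ _ hz
    split_ifs <;> first | linarith | tauto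
  have h4 : (m * (coveredPairs G).card : ℝ) < 6 * G.card := by exact_mod_cast h
  rw [sum_excess hG] at h3
  simp only [Finset.sum_add_distrib] at h3
  by_contra! hcon
  have := Finset.sum_nonneg fun (p : V × V) (_ : p ∈ Finset.univ) => hcon p.1 p.2
  linarith

/-- In a dense `3`-graph some edge `{x, y, z}` of negative excess satisfies `C` and there are many
further edges of small excess on the pair `x`, `y`. -/
lemma exists_light_center (hG : ∀ g ∈ G, g.card = 3)
    (h : m * (coveredPairs G).card < 6 * G.card) (C : V → V → V → Prop)
    (hC : ∀ x y z, z ∈ third G x y → C x y z ∨ C y z x ∨ C z x y) {δ : ℝ} (hδ : 0 < δ) :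
    ∃ x y, ∃ z ∈ third G x y, C x y z ∧ excess G m x y z < 0 ∧
      ∀ K : ℕ, K * -excess G m x y z ≤ ((third G x y).card - K) * (δ / 3) →
        K < ((third G x y).filter fun w => excess G m x y w < δ).card := by
  classical
  obtain ⟨x, y, hxy⟩ := exists_sum_charge_neg hG h C hC
  have hne : ((third G x y).filter fun z => excess G m x y z < 0 ∧ C x y z).Nonempty := by
    by_contra hcon
    rw [Finset.not_nonempty_iff_eq_empty, Finset.filter_eq_empty_iff] at hcon
    refine hxy.not_ge (Finset.sum_nonneg fun z hz => ?_)
    split_ifs with h1 h2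
    · positivity
    · exact absurd ⟨not_le.1 h1, h2⟩ (hcon hz)
    · exact le_rfl
  obtain ⟨z, hz, hmin⟩ := Finset.exists_min_image _ (excess G m x y) hne
  simp only [Finset.mem_filter] at hz hmin
  refine ⟨x, y, z, hz.1, hz.2.2, hz.2.1, fun K hK => ?_⟩
  by_contra! hcon
  set Y := (third G x y).filter fun w => excess G m x y w < δ
  have hsum : ∑ w ∈ third G x y, (if excess G m x y w < δ then excess G m x y z else δ / 3) ≤
      ∑ w ∈ third G x y, (if 0 ≤ excess G m x y w then excess G m x y w / 3 else
      if C x y w then excess G m x y w else 0) := by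
    refine Finset.sum_le_sum fun w hw => ?_
    have := hmin w
    split_ifs <;> first | linarith [hz.2.1] | exact this ⟨hw, by linarith, by assumption⟩
  rw [Finset.sum_ite, Finset.sum_const, Finset.sum_const, nsmul_eq_mul, nsmul_eq_mul] at hsum
  have hcard : ((Y.card : ℝ) + (((third G x y).filter fun w => ¬ excess G m x y w < δ).card : ℝ)) =
      (third G x y).card := by
    exact_mod_cast Finset.card_filter_add_card_filter_not _
  have hYK : (Y.card : ℝ) ≤ K := by exact_mod_cast hcon
  nlinarith [hz.2.1]

end discharging

/-- One of the four ways to map a two-trunk with demands `α`, `β₁`, `β₂`, `γ₁`, `γ₂` onto two edges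
sharing a pair fits the supplies. -/
def CanFit (α β₁ β₂ γ₁ γ₂ : ℕ) (N : Fin 5 → ℕ) : Prop :=
  Fits ![α, β₁, β₂, γ₁, γ₂] N ∨ Fits ![α, β₂, β₁, γ₂, γ₁] N ∨
    Fits ![α, γ₁, γ₂, β₁, β₂] N ∨ Fits ![α, γ₂, γ₁, β₂, β₁] N

lemma fits_iff {α p q r s D u v x y : ℕ} : Fits ![α, p, q, r, s] ![D, u, v, x, y] ↔
    ((if D ≤ D then α else 0) + (if u ≤ D then p else 0) + (if v ≤ D then q else 0) +
      (if x ≤ D then r else 0) + (if y ≤ D then s else 0) ≤ D) ∧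
    ((if D ≤ u then α else 0) + (if u ≤ u then p else 0) + (if v ≤ u then q else 0) +
      (if x ≤ u then r else 0) + (if y ≤ u then s else 0) ≤ u) ∧
    ((if D ≤ v then α else 0) + (if u ≤ v then p else 0) + (if v ≤ v then q else 0) +
      (if x ≤ v then r else 0) + (if y ≤ v then s else 0) ≤ v) ∧
    ((if D ≤ x then α else 0) + (if u ≤ x then p else 0) + (if v ≤ x then q else 0) +
      (if x ≤ x then r else 0) + (if y ≤ x then s else 0) ≤ x) ∧
    ((if D ≤ y then α else 0) + (if u ≤ y then p else 0) + (if v ≤ y then q else 0) +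
      (if x ≤ y then r else 0) + (if y ≤ y then s else 0) ≤ y) := by
  have h5 : ∀ P : Fin 5 → Prop, (∀ i, P i) ↔ P 0 ∧ P 1 ∧ P 2 ∧ P 3 ∧ P 4 := fun P => by
    simp [Fin.forall_fin_succ]
  rw [Fits, h5]
  simp only [Fin.sum_univ_five]
  exact Iff.rfl

lemma canFit_swap {α β₁ β₂ γ₁ γ₂ D u v x y : ℕ} (h : CanFit α β₁ β₂ γ₂ γ₁ ![D, u, v, x, y]) :
    CanFit α β₁ β₂ γ₁ γ₂ ![D, u, v, y, x] := by
  simp only [CanFit, fits_iff] at h ⊢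
  rcases h with h | h | h | h
  · left; omega
  · right; left; omega
  · right; right; right; omega
  · right; right; left; omega

lemma canFit_of_small_of_lt_right {m α β₁ β₂ γ₁ γ₂ D u v x y : ℕ} (hm : 19 ≤ m)
    (hs : α + β₁ + β₂ + γ₁ + γ₂ + 1 = m) (hα : 3 * α + 3 ≤ m)
    (huv : u ≤ v) (hxy : x ≤ y) (hD : m < 3 * D) (hx : m < 3 * x)
    (hu : 2 * m < 3 * u) (hv : m < v)
    (hDx' : 10 * m < 17 * D ∨ 10 * m < 17 * x) (hy : m < y) :
    CanFit α β₁ β₂ γ₁ γ₂ ![D - 2, u - 2, v - 2, x - 2, y - 2] := by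
  have key : ∀ p q r s, α + p + q + r + s + 1 = m → p + r ≤ q + s → r ≤ p →
      Fits ![α, p, q, r, s] ![D - 2, u - 2, v - 2, x - 2, y - 2] := by
    intro p q r s h1 h2 h3
    rw [fits_iff]
    refine ⟨?_, ?_, ?_, ?_, ?_⟩ <;> split_ifs <;> omega
  rcases le_total (β₁ + γ₁) (β₂ + γ₂) with h1 | h1 <;>
    [rcases le_total γ₁ β₁ with h2 | h2; rcases le_total γ₂ β₂ with h2 | h2]
  · exact Or.inl (key _ _ _ _ (by omega) h1 h2)
  · exact Or.inr (Or.inr (Or.inl (key _ _ _ _ (by omega) (by omega) h2)))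
  · exact Or.inr (Or.inl (key _ _ _ _ (by omega) h1 h2))
  · exact Or.inr (Or.inr (Or.inr (key _ _ _ _ (by omega) (by omega) h2)))

lemma canFit_of_small_of_lt_left {m α β₁ β₂ γ₁ γ₂ D u v x y : ℕ} (hm : 19 ≤ m)
    (hs : α + β₁ + β₂ + γ₁ + γ₂ + 1 = m) (hα : 3 * α + 3 ≤ m)
    (huv : u ≤ v) (hxy : x ≤ y) (hDu : D ≤ u) (hD : m < 3 * D) (hx : m < 3 * x)
    (hu : m < u)
    (hDx' : 10 * m < 17 * D ∨ 10 * m < 17 * x) (hy : 10 * m < 17 * y)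
    (hDy : 15 * m < 17 * D ∨ 15 * m < 17 * y) :
    CanFit α β₁ β₂ γ₁ γ₂ ![D - 2, u - 2, v - 2, x - 2, y - 2] := by
  have key : ∀ p q r s, α + p + q + r + s + 1 = m → r + s ≤ p + q → r ≤ s →
      Fits ![α, p, q, r, s] ![D - 2, u - 2, v - 2, x - 2, y - 2] := by
    intro p q r s h1 h2 h3
    rw [fits_iff]
    refine ⟨?_, ?_, ?_, ?_, ?_⟩ <;> split_ifs <;> omega
  rcases le_total (γ₁ + γ₂) (β₁ + β₂) with h1 | h1 <;>
    [rcases le_total γ₁ γ₂ with h2 | h2; rcases le_total β₁ β₂ with h2 | h2]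
  · exact Or.inl (key _ _ _ _ (by omega) h1 h2)
  · exact Or.inr (Or.inl (key _ _ _ _ (by omega) (by omega) h2))
  · exact Or.inr (Or.inr (Or.inl (key _ _ _ _ (by omega) h1 h2)))
  · exact Or.inr (Or.inr (Or.inr (key _ _ _ _ (by omega) (by omega) h2)))

lemma canFit_of_small_of_balanced {m α β₁ β₂ γ₁ γ₂ D u v x y : ℕ} (hm : 19 ≤ m)
    (hs : α + β₁ + β₂ + γ₁ + γ₂ + 1 = m) (hα : 3 * α + 3 ≤ m)
    (huv : u ≤ v) (hxy : x ≤ y) (hDu : D ≤ u)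
    (hD : m < 3 * D) (hu : 2 * m < 3 * u) (hv : m < v)
    (hx : 5 * m < 7 * x) (hy : 5 * m < 6 * y)
    (hux : 5 * m < 6 * u ∨ 5 * m < 6 * x) (huy : 15 * m < 17 * u ∨ 15 * m < 17 * y) :
    CanFit α β₁ β₂ γ₁ γ₂ ![D - 2, u - 2, v - 2, x - 2, y - 2] := by
  have key : ∀ p q r s, α + p + q + r + s + 1 = m → p ≤ q → r ≤ q → s ≤ q →
      Fits ![α, p, q, r, s] ![D - 2, u - 2, v - 2, x - 2, y - 2] := by
    intro p q r s h1 h2 h3 h4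
    rw [fits_iff]
    refine ⟨?_, ?_, ?_, ?_, ?_⟩ <;> split_ifs <;> omega
  have h : (β₂ ≤ β₁ ∧ γ₁ ≤ β₁ ∧ γ₂ ≤ β₁) ∨ (β₁ ≤ β₂ ∧ γ₁ ≤ β₂ ∧ γ₂ ≤ β₂) ∨
      (β₁ ≤ γ₁ ∧ β₂ ≤ γ₁ ∧ γ₂ ≤ γ₁) ∨ (β₁ ≤ γ₂ ∧ β₂ ≤ γ₂ ∧ γ₁ ≤ γ₂) := by omega
  rcases h with h | h | h | h
  · exact Or.inr (Or.inl (key _ _ _ _ (by omega) (by omega) (by omega) (by omega)))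
  · exact Or.inl (key _ _ _ _ (by omega) (by omega) (by omega) (by omega))
  · exact Or.inr (Or.inr (Or.inr (key _ _ _ _ (by omega) (by omega) (by omega) (by omega))))
  · exact Or.inr (Or.inr (Or.inl (key _ _ _ _ (by omega) (by omega) (by omega) (by omega))))

lemma canFit_of_large_of_le_right {m α β₁ β₂ γ₁ γ₂ D u v x y : ℕ}
    (hs : α + β₁ + β₂ + γ₁ + γ₂ + 1 = m)
    (hD : m ≤ D + 1) (hu : β₁ + β₂ + γ₁ + γ₂ ≤ 2 * u + 1) (hv : β₁ + β₂ + γ₁ + γ₂ ≤ v)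
    (hx : β₁ + β₂ + γ₁ + γ₂ ≤ 4 * x + 3) (hy : β₁ + β₂ + γ₁ + γ₂ ≤ y) :
    CanFit α β₁ β₂ γ₁ γ₂ ![D, u, v, x, y] := by
  have key : ∀ p q r s, p + q + r + s = β₁ + β₂ + γ₁ + γ₂ → p + r ≤ q + s → r ≤ p →
      Fits ![α, p, q, r, s] ![D, u, v, x, y] := by
    intro p q r s h1 h2 h3
    rw [fits_iff]
    refine ⟨?_, ?_, ?_, ?_, ?_⟩ <;> split_ifs <;> omega
  rcases le_total (β₁ + γ₁) (β₂ + γ₂) with h1 | h1 <;>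
    [rcases le_total γ₁ β₁ with h2 | h2; rcases le_total γ₂ β₂ with h2 | h2]
  · exact Or.inl (key _ _ _ _ (by omega) h1 h2)
  · exact Or.inr (Or.inr (Or.inl (key _ _ _ _ (by omega) (by omega) h2)))
  · exact Or.inr (Or.inl (key _ _ _ _ (by omega) h1 h2))
  · exact Or.inr (Or.inr (Or.inr (key _ _ _ _ (by omega) (by omega) h2)))

lemma canFit_of_large_of_balanced {m α β₁ β₂ γ₁ γ₂ D u v x y : ℕ}
    (hs : α + β₁ + β₂ + γ₁ + γ₂ + 1 = m)
    (hD : m ≤ D + 1) (hu : β₁ + β₂ + γ₁ + γ₂ ≤ 2 * u + 1) (hv : β₁ + β₂ + γ₁ + γ₂ ≤ v)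
    (hx : 3 * (β₁ + β₂ + γ₁ + γ₂) ≤ 4 * x + 3) (hxy : x ≤ y) :
    CanFit α β₁ β₂ γ₁ γ₂ ![D, u, v, x, y] := by
  have key : ∀ p q r s, p + q + r + s = β₁ + β₂ + γ₁ + γ₂ → r + s ≤ p + q → p ≤ q →
      Fits ![α, p, q, r, s] ![D, u, v, x, y] := by
    intro p q r s h1 h2 h3
    rw [fits_iff]
    refine ⟨?_, ?_, ?_, ?_, ?_⟩ <;> split_ifs <;> omega
  rcases le_total (γ₁ + γ₂) (β₁ + β₂) with h1 | h1 <;>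
    [rcases le_total β₁ β₂ with h2 | h2; rcases le_total γ₁ γ₂ with h2 | h2]
  · exact Or.inl (key _ _ _ _ (by omega) h1 h2)
  · exact Or.inr (Or.inl (key _ _ _ _ (by omega) (by omega) h2))
  · exact Or.inr (Or.inr (Or.inl (key _ _ _ _ (by omega) h1 h2)))
  · exact Or.inr (Or.inr (Or.inr (key _ _ _ _ (by omega) (by omega) h2)))

lemma canFit_swap_both {α β₁ β₂ γ₁ γ₂ D u v x y : ℕ} (h : CanFit α β₁ β₂ γ₁ γ₂ ![D, u, v, x, y]) :
    CanFit α β₁ β₂ γ₁ γ₂ ![D, v, u, y, x] := by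
  simp only [CanFit, fits_iff] at h ⊢
  rcases h with h | h | h | h
  · right; left; omega
  · left; omega
  · right; right; right; omega
  · right; right; left; omega

lemma three_mul_add_five_le {m S x y : ℕ} (hm : 19 ≤ m) (hS : 3 * S + 1 ≤ 2 * m) (hy : y ≤ S + 1)
    (h : 3 * m * (x + y) < 10 * x * y) : 3 * S + 5 ≤ 4 * x := by
  by_contra! hx
  have h1 : 3 * m < 10 * x := by
    by_contra! hcon
    nlinarith [Nat.mul_le_mul_right y hcon, Nat.zero_le (m * x)]
  have h2 : 3 * m * (x + (S + 1)) < 10 * x * (S + 1) := by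
    nlinarith [Nat.mul_le_mul h1.le hy]
  by_cases hS17 : 17 ≤ S
  · nlinarith [Nat.mul_le_mul hS (Nat.le_refl (x + (S + 1)))]
  · have : S < 17 := by omega
    obtain ⟨P, hP⟩ : ∃ P, P = m * (x + (S + 1)) := ⟨_, rfl⟩
    have h3 : 19 * (x + (S + 1)) ≤ P := hP ▸ Nat.mul_le_mul_right _ hm
    have h4 : (3 * S + 2) / 2 * (x + (S + 1)) ≤ P := hP ▸ Nat.mul_le_mul_right _ (by omega)
    have h5 : 3 * P < 10 * (x * (S + 1)) := by rw [hP, ← mul_assoc, ← mul_assoc]; exact h2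
    clear h hP h2
    interval_cases S <;> omega

lemma div_le_div_of_mul_le {D m k l : ℕ} (hD : 0 < D) (h : k * D ≤ l * m) :
    (k / l : ℝ) ≤ m / D := by
  obtain rfl | hl := l.eq_zero_or_pos
  · simp only [Nat.cast_zero, div_zero]
    positivity
  rw [div_le_div_iff₀ (by positivity) (by positivity)]
  have : (k : ℝ) * D ≤ l * m := by exact_mod_cast h
  linarith

lemma canFit_of_small {m α β₁ β₂ γ₁ γ₂ D u v x y : ℕ} (hm : 19 ≤ m)
    (hs : α + β₁ + β₂ + γ₁ + γ₂ + 1 = m) (hα : 3 * α + 3 ≤ m) (hDu : D ≤ u) (hDv : D ≤ v)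
    (hD : m < 3 * D) (hx : m < 3 * x) (hy : m < 3 * y)
    (he : (m / D + m / u + m / v : ℝ) < 3) (hf : (m / D + m / x + m / y : ℝ) < 17 / 5) :
    CanFit α β₁ β₂ γ₁ γ₂ ![D - 2, u - 2, v - 2, x - 2, y - 2] := by
  wlog huv : u ≤ v generalizing u v x y
  · exact canFit_swap_both (this hDv hDu hy hx (by linarith) (by linarith) (le_of_not_ge huv))
  wlog hxy : x ≤ y generalizing x y β₁ β₂ γ₁ γ₂
  · exact canFit_swap (this (by omega) hy hx (by linarith) (le_of_not_ge hxy))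
  have key : ∀ {E k l : ℕ}, m < 3 * E → k * E ≤ l * m → (k / l : ℝ) ≤ m / E :=
    fun h => div_le_div_of_mul_le (by omega)
  have hu' : m < 3 * u := by omega
  have hv' : m < 3 * v := by omega
  have hu : 2 * m < 3 * u := by
    by_contra! h
    have h1 := key (k := 3) (l := 2) hu' h
    have h2 := key (k := 3) (l := 2) hD (by omega)
    have : (0 : ℝ) ≤ m / v := by positivity
    norm_num at h1 h2
    linarith
  have hv : m < v := by
    by_contra! h
    have h1 := key (k := 1) (l := 1) hu' (by omega)
    have h2 := key (k := 1) (l := 1) hD (by omega)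
    have h3 := key (k := 1) (l := 1) hv' (by omega)
    norm_num at h1 h2 h3
    linarith
  have h17 : ∀ {E F : ℕ} {r : ℝ}, m < 3 * E → m < 3 * F → (m / E + m / F : ℝ) + r < 17 / 5 →
      0 ≤ r → 10 * m < 17 * E ∨ 10 * m < 17 * F := by
    intro E F r hE hF hr hr0
    by_contra! h
    have h1 := key (k := 17) (l := 10) hE h.1
    have h2 := key (k := 17) (l := 10) hF h.2
    norm_num at h1 h2
    linarith
  have h15 : ∀ {E : ℕ}, m < 3 * E → (m / E + m / x + m / y : ℝ) < 17 / 5 →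
      15 * m < 17 * E ∨ 15 * m < 17 * y := by
    intro E hE hr
    by_contra! h
    have h1 := key (k := 17) (l := 15) hE h.1
    have h2 := key (k := 17) (l := 15) hx (by omega)
    have h3 := key (k := 17) (l := 15) hy h.2
    norm_num at h1 h2 h3
    linarith
  have hDx := h17 hD hx hf (by positivity)
  by_cases hym : m < y
  · exact canFit_of_small_of_lt_right hm hs hα huv hxy hD hx hu hv hDx hym
  by_cases hum : m < u
  · refine canFit_of_small_of_lt_left hm hs hα huv hxy hDu hD hx hum hDx ?_ (h15 hD hf)
    have := h17 hx hy (r := m / D) (by linarith) (by positivity)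
    omega
  have h1D := key (k := 1) (l := 1) hD (by omega)
  have h1y := key (k := 1) (l := 1) hy (by omega)
  have hDu' : (m / u : ℝ) ≤ m / D := by
    have : (0 : ℝ) < D := by exact_mod_cast (by omega : 0 < D)
    gcongr
  norm_num at h1D h1y
  refine canFit_of_small_of_balanced hm hs hα huv hxy hDu hD hu hv ?_ ?_ ?_ (h15 hu' (by linarith))
  · by_contra! h
    have := key (k := 7) (l := 5) hx h
    norm_num at this
    linarith
  · by_contra! h
    have h1 := key (k := 6) (l := 5) hx (by omega)
    have h2 := key (k := 6) (l := 5) hy h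
    norm_num at h1 h2
    linarith
  · by_contra! h
    have h1 := key (k := 6) (l := 5) hx h.2
    have h2 := key (k := 6) (l := 5) hu' h.1
    norm_num at h1 h2
    linarith

lemma canFit_of_large {m α β₁ β₂ γ₁ γ₂ D u v x y : ℕ} (hm : 19 ≤ m)
    (hs : α + β₁ + β₂ + γ₁ + γ₂ + 1 = m) (hα : m < 3 * α + 3) (hD : m ≤ D + 1)
    (hu : β₁ + β₂ + γ₁ + γ₂ ≤ 2 * u + 1) (hv : β₁ + β₂ + γ₁ + γ₂ ≤ v)
    (hx : m < 3 * x) (hy : m < 3 * y) (hf : (m / x + m / y : ℝ) < 10 / 3) :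
    CanFit α β₁ β₂ γ₁ γ₂ ![D, u, v, x - 2, y - 2] := by
  wlog hxy : x ≤ y generalizing x y β₁ β₂ γ₁ γ₂
  · exact canFit_swap (this (by omega) (by omega) (by omega) hy hx (by linarith)
      (le_of_not_ge hxy))
  by_cases hyS : β₁ + β₂ + γ₁ + γ₂ ≤ y - 2
  · exact canFit_of_large_of_le_right hs hD hu hv (by omega) hyS
  · have hx0 : (0 : ℝ) < x := by exact_mod_cast (by omega : 0 < x)
    have hy0 : (0 : ℝ) < y := by exact_mod_cast (by omega : 0 < y)
    have : 3 * m * (x + y) < 10 * x * y := by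
      rw [div_add_div _ _ hx0.ne' hy0.ne', div_lt_div_iff₀ (by positivity) (by norm_num)] at hf
      have : (3 * m * (x + y) : ℝ) < 10 * x * y := by linarith
      exact_mod_cast this
    have := three_mul_add_five_le (S := β₁ + β₂ + γ₁ + γ₂) hm (by omega) (by omega) this
    exact canFit_of_large_of_balanced hs hD hu hv (by omega) (by omega)

lemma card_third_sub_le_dprime [Fintype V] [DecidableEq V] {G : Finset (Finset V)}
    {S : Finset V} {x y : V} (R : Finset V) (hR : ∀ z ∈ S, z ∈ third G x y → z ∈ R) :
    (third G x y).card - R.card ≤ dprime G S x y := by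
  rw [Nat.sub_le_iff_le_add]
  refine (Finset.card_le_card fun z hz => ?_).trans (Finset.card_union_le _ _)
  rw [Finset.mem_union, Finset.mem_filter]
  by_cases hzS : z ∈ S
  · exact Or.inr (hR z hzS hz)
  · exact Or.inl ⟨Finset.mem_univ z, hzS, mem_third.1 hz⟩

lemma dprime_comm [Fintype V] [DecidableEq V] (G : Finset (Finset V)) (S : Finset V) (x y : V) :
    dprime G S x y = dprime G S y x := by
  simp only [dprime, Finset.insert_comm x y]

/-- A two-trunk with its leaves embeds over two edges on the pair `a`, `b` if the demands can fit
the supplies. -/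
lemma IsTwoTrunk.containsCopy_of_canFit [DecidableEq V] {W : Type*} [Fintype W] [DecidableEq W]
    {T : Finset (Finset V)} {a₀ b₀ c₀ d₀ : V} {ℓ : Finset V → V} {κ : Finset V → Fin 5}
    (h : IsTwoTrunk T a₀ b₀ c₀ d₀ ℓ κ) {G : Finset (Finset W)} (hG : ∀ g ∈ G, g.card = 3)
    {a b c d : W} (hc : c ∈ third G a b) (hd : d ∈ third G a b) (hcd : c ≠ d) {D u v x y : ℕ}
    (hD : D ≤ dprime G {a, b, c, d} a b) (hu : u ≤ dprime G {a, b, c, d} a c)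
    (hv : v ≤ dprime G {a, b, c, d} b c) (hx : x ≤ dprime G {a, b, c, d} a d)
    (hy : y ≤ dprime G {a, b, c, d} b d)
    (hfit : CanFit (demand T a₀ b₀ c₀ d₀ κ 0) (demand T a₀ b₀ c₀ d₀ κ 1)
      (demand T a₀ b₀ c₀ d₀ κ 2) (demand T a₀ b₀ c₀ d₀ κ 3) (demand T a₀ b₀ c₀ d₀ κ 4)
      ![D, u, v, x, y]) : ContainsCopy G T := by
  have hnc := nodup_of_mem_third hG hc
  have hnd := nodup_of_mem_third hG hd
  have hc' := third_comm G a b ▸ hc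
  have hd' := third_comm G a b ▸ hd
  rw [mem_third] at hc hd hc' hd'
  have hdem : demand T a₀ b₀ c₀ d₀ κ = ![demand T a₀ b₀ c₀ d₀ κ 0, demand T a₀ b₀ c₀ d₀ κ 1,
      demand T a₀ b₀ c₀ d₀ κ 2, demand T a₀ b₀ c₀ d₀ κ 3, demand T a₀ b₀ c₀ d₀ κ 4] := by
    ext i; fin_cases i <;> rfl
  have hS1 : ({b, a, c, d} : Finset W) = {a, b, c, d} := Finset.insert_comm _ _ _
  have hS2 : ({a, b, d, c} : Finset W) = {a, b, c, d} := by rw [Finset.pair_comm d c]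
  have hS3 : ({b, a, d, c} : Finset W) = {a, b, c, d} := by rw [Finset.insert_comm, hS2]
  rcases hfit with hfit | hfit | hfit | hfit
  · refine h.containsCopy (by simp; tauto) hc hd ![D, u, v, x, y] ?_ (hdem ▸ hfit)
    simp [Fin.forall_fin_succ, trunkPair, hD, hu, hv, hx, hy]
  · refine h.containsCopy (by simp; tauto) hc' hd' ![D, v, u, y, x] ?_ ?_
    · simp [Fin.forall_fin_succ, trunkPair, hS1, dprime_comm G _ b a, hD, hu, hv, hx, hy]
    · rw [hdem]; rw [fits_iff] at hfit ⊢; omega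
  · refine h.containsCopy (by simp; tauto) hd hc ![D, x, y, u, v] ?_ ?_
    · simp [Fin.forall_fin_succ, trunkPair, hS2, hD, hu, hv, hx, hy]
    · rw [hdem]; rw [fits_iff] at hfit ⊢; omega
  · refine h.containsCopy (by simp; tauto) hd' hc' ![D, y, x, v, u] ?_ ?_
    · simp [Fin.forall_fin_succ, trunkPair, hS3, dprime_comm G _ b a, hD, hu, hv, hx, hy]
    · rw [hdem]; rw [fits_iff] at hfit ⊢; omega

section dprime

variable [Fintype V] [DecidableEq V] {G : Finset (Finset V)} {a b c d : V}

lemma card_third_sub_two_le_dprime (hG : ∀ g ∈ G, g.card = 3) {x y : V}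
    (hx : x ∈ ({a, b, c, d} : Finset V)) (hy : y ∈ ({a, b, c, d} : Finset V)) (hxy : x ≠ y) :
    (third G x y).card - 2 ≤ dprime G {a, b, c, d} x y := by
  have hsub : ({x, y} : Finset V) ⊆ {a, b, c, d} := Finset.insert_subset hx (by simpa using hy)
  have h := card_third_sub_le_dprime (G := G) (S := {a, b, c, d}) (x := x) (y := y)
    (({a, b, c, d} : Finset V) \ {x, y}) fun z hz hz' => by
      have := nodup_of_mem_third hG hz'
      rw [Finset.mem_sdiff]
      refine ⟨hz, fun hxy' => ?_⟩
      rw [Finset.mem_insert, Finset.mem_singleton] at hxy'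
      rcases hxy' with rfl | rfl <;> tauto
  rw [Finset.card_sdiff_of_subset hsub, Finset.card_pair hxy] at h
  have := Finset.card_le_four (a := a) (b := b) (c := c) (d := d)
  omega

lemma card_third_sub_one_le_dprime (hG : ∀ g ∈ G, g.card = 3) (hd : d ∉ third G a c) :
    (third G a c).card - 1 ≤ dprime G {a, b, c, d} a c := by
  refine card_third_sub_le_dprime {b} fun z hz hz' => ?_
  have := nodup_of_mem_third hG hz'
  simp only [Finset.mem_insert, Finset.mem_singleton] at hz ⊢
  rcases hz with rfl | rfl | rfl | rfl <;> tauto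

/-- If there are more than `(third G a c).card` vertices `d` in a subset of `third G a b`, then
some `d ≠ c` among them does not form an edge with `a` and `c`. -/
lemma exists_notMem_third (hc : c ∈ third G a b) {Y : Finset V}
    (hG : ∀ g ∈ G, g.card = 3) (hY : Y ⊆ third G a b) (hcard : (third G a c).card < Y.card) :
    ∃ d ∈ Y, d ≠ c ∧ d ∉ third G a c := by
  by_contra! hcon
  have hb : b ∈ third G a c := mem_third_swap.1 hc
  have hsub : Y.erase c ⊆ (third G a c).erase b := fun d hd => by
    rw [Finset.mem_erase] at hd ⊢
    exact ⟨(nodup_of_mem_third hG (hY hd.2)).2.2.symm, hcon d hd.2 hd.1⟩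
  have h1 := Finset.card_le_card hsub
  have h2 := Finset.pred_card_le_card_erase (s := Y) (a := c)
  have h3 := Finset.card_erase_lt_of_mem hb
  omega

end dprime

lemma three_sub_div_le {m D : ℕ} (hm : 19 ≤ m) (hD : 0 < D) :
    (3 - m / D : ℝ) ≤ (D - 1) * (2 / 5 / 3) := by
  have hD' : (0 : ℝ) < D := by exact_mod_cast hD
  have hm' : (19 : ℝ) ≤ m := by exact_mod_cast hm
  rw [sub_le_iff_le_add, ← sub_le_iff_le_add', le_div_iff₀ hD']
  nlinarith [sq_nonneg ((D : ℝ) - 12)]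

lemma three_sub_div_le' {m D : ℕ} (hm : 19 ≤ m) (hD : m < D) :
    (3 - m / D : ℝ) ≤ (D - 1) * (1 / 3 / 3) := by
  have hD' : (20 : ℝ) ≤ D := by exact_mod_cast (by omega : 20 ≤ D)
  have hm' : (19 : ℝ) ≤ m := by exact_mod_cast hm
  rw [sub_le_iff_le_add, ← sub_le_iff_le_add', le_div_iff₀ (by positivity)]
  nlinarith

/-- If `u` is small, then so is the deficit of the edge compared with its largest codegree. -/
lemma bounds_of_small_fst {m u v D : ℕ} (hm : 19 ≤ m) (hu0 : m < 3 * u) (hu : 3 * u ≤ m + 2)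
    (huv : u ≤ v) (hvD : v ≤ D) (h : (m / D + m / u + m / v : ℝ) < 3) :
    m + 2 ≤ v ∧ u * (3 - (m / D + m / u + m / v : ℝ)) ≤ (D - u) * (1 / 3 / 3) := by
  have hm' : (19 : ℝ) ≤ m := by exact_mod_cast hm
  have hu' : (0 : ℝ) < u := by exact_mod_cast (by omega : 0 < u)
  have hv' : (0 : ℝ) < v := by exact_mod_cast (by omega : 0 < v)
  have hD' : (v : ℝ) ≤ D := by exact_mod_cast hvD
  have hum : (3 * u : ℝ) ≤ m + 2 := by exact_mod_cast hu
  have h1 : (3 * m / (m + 2) : ℝ) ≤ m / u := by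
    rw [div_le_div_iff₀ (by positivity) hu']
    nlinarith
  have h2 : (0 : ℝ) ≤ m / D := by positivity
  have h3 : (m / v : ℝ) < 6 / (m + 2) := by
    have : (6 / (m + 2) : ℝ) = 3 - 3 * m / (m + 2) := by field_simp; ring
    linarith
  rw [div_lt_div_iff₀ hv' (by positivity)] at h3
  have h4 : (u * (m / u) : ℝ) = m := by field_simp
  have h5 : (0 : ℝ) ≤ m / v := by positivity
  constructor
  · have : (m + 2 : ℝ) ≤ v := by nlinarith
    exact_mod_cast this
  · nlinarith [mul_nonneg hu'.le h2, mul_nonneg hu'.le h5]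

/-- If `v` is small, then so is the deficit of the edge compared with its largest codegree. -/
lemma bounds_of_small_snd {m u v D : ℕ} (hm : 19 ≤ m) (hu0 : m < 3 * u) (hv : 3 * v ≤ 2 * m + 2)
    (huv : u ≤ v) (hvD : v ≤ D) (h : (m / D + m / u + m / v : ℝ) < 3) :
    v * (3 - (m / D + m / u + m / v : ℝ)) ≤ (D - v) * (1 / 3 / 3) := by
  have hm' : (19 : ℝ) ≤ m := by exact_mod_cast hm
  have hu' : (0 : ℝ) < u := by exact_mod_cast (by omega : 0 < u)
  have huv' : (u : ℝ) ≤ v := by exact_mod_cast huv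
  have hD' : (0 : ℝ) < D := by exact_mod_cast (by omega : 0 < D)
  have hvm : (3 * v : ℝ) ≤ 2 * m + 2 := by exact_mod_cast hv
  have hv' : (0 : ℝ) < v := hu'.trans_le huv'
  have h1 : (3 * m / (2 * m + 2) : ℝ) ≤ m / v := by
    rw [div_le_div_iff₀ (by positivity) hv']
    nlinarith
  have h2 : (m / v : ℝ) ≤ m / u := by gcongr
  have h3 : (m / D : ℝ) < 3 / (m + 1) := by
    have : (3 / (m + 1) : ℝ) = 3 - 2 * (3 * m / (2 * m + 2)) := by field_simp; ring
    linarith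
  have h4 : (v * (3 - (m / D + m / u + m / v)) : ℝ) ≤ 2 := by
    have h5 : (3 - (m / D + m / u + m / v) : ℝ) ≤ 3 / (m + 1) := by
      have : (3 / (m + 1) : ℝ) = 3 - 2 * (3 * m / (2 * m + 2)) := by field_simp; ring
      have : (0 : ℝ) ≤ m / D := by positivity
      linarith
    calc (v * (3 - (m / D + m / u + m / v)) : ℝ) ≤ v * (3 / (m + 1)) := by gcongr
      _ ≤ 2 := by
        rw [← mul_div_assoc, div_le_iff₀ (by positivity)]
        linarith
  rw [div_lt_div_iff₀ hD' (by positivity)] at h3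
  nlinarith

/-- A dense `3`-graph in which all positive codegrees are large contains every tight `3`-tree with
a two-trunk. -/
lemma IsTwoTrunk.containsCopy_of_dense [DecidableEq V] {W : Type*} [Fintype W] [DecidableEq W]
    {T : Finset (Finset V)} {a₀ b₀ c₀ d₀ : V} {ℓ : Finset V → V} {κ : Finset V → Fin 5}
    (h : IsTwoTrunk T a₀ b₀ c₀ d₀ ℓ κ) {m : ℕ} (hm : 19 ≤ m) (hT : T.card = m + 1)
    {G : Finset (Finset W)} (hG : ∀ g ∈ G, g.card = 3)
    (hdense : m * (coveredPairs G).card < 6 * G.card)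
    (hcod : ∀ x y, (third G x y).Nonempty → m < 3 * (third G x y).card) : ContainsCopy G T := by
  have hs := h.sum_demand
  rw [Fin.sum_univ_five, hT] at hs
  have hcod' : ∀ {x y z}, z ∈ third G x y → m < 3 * (third G x y).card ∧
      m < 3 * (third G x z).card ∧ m < 3 * (third G y z).card := fun hz =>
    ⟨hcod _ _ ⟨_, hz⟩, hcod _ _ ⟨_, mem_third_swap.1 hz⟩, hcod _ _ ⟨_, mem_third_rotate.1 hz⟩⟩
  have hex : ∀ x y z, excess G m x y z = (m / (third G x y).card + m / (third G x z).card +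
      m / (third G y z).card : ℝ) - 3 := fun x y z => by
    rw [excess, ratio_comm G m z x, ratio, ratio, ratio]; ring
  have hdp : ∀ {a b c d}, c ∈ third G a b → d ∈ third G a b →
      (third G a b).card - 2 ≤ dprime G {a, b, c, d} a b ∧
      (third G a c).card - 2 ≤ dprime G {a, b, c, d} a c ∧
      (third G b c).card - 2 ≤ dprime G {a, b, c, d} b c ∧
      (third G a d).card - 2 ≤ dprime G {a, b, c, d} a d ∧
      (third G b d).card - 2 ≤ dprime G {a, b, c, d} b d := fun hc hd => by
    have hnc := nodup_of_mem_third hG hc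
    have hnd := nodup_of_mem_third hG hd
    refine ⟨?_, ?_, ?_, ?_, ?_⟩ <;>
      exact card_third_sub_two_le_dprime hG (by simp) (by simp) (by tauto)
  by_cases hα : 3 * demand T a₀ b₀ c₀ d₀ κ 0 + 3 ≤ m
  · obtain ⟨a, b, c, hc, hmin, hlight, hmany⟩ := exists_light_center hG hdense
      (fun x y z => (third G x y).card ≤ (third G x z).card ∧
        (third G x y).card ≤ (third G y z).card)
      (fun x y z _ => by
        rw [third_comm G y x, third_comm G z x, third_comm G z y]; omega)
      (δ := 2 / 5) (by norm_num)
    obtain ⟨hab, hac, hbc⟩ := hcod' hc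
    have hY := hmany 1 (by
      have := three_sub_div_le hm (D := (third G a b).card) (by omega)
      have h1 : (0 : ℝ) ≤ m / (third G a c).card := by positivity
      have h2 : (0 : ℝ) ≤ m / (third G b c).card := by positivity
      rw [hex]
      push_cast
      linarith)
    obtain ⟨d, hdY, hdc⟩ := Finset.exists_mem_ne hY c
    obtain ⟨hd, hdex⟩ := Finset.mem_filter.1 hdY
    obtain ⟨-, had, hbd⟩ := hcod' hd
    obtain ⟨h1, h2, h3, h4, h5⟩ := hdp hc hd
    rw [hex] at hlight hdex
    exact h.containsCopy_of_canFit hG hc hd hdc.symm h1 h2 h3 h4 h5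
      (canFit_of_small hm (by omega) hα hmin.1 hmin.2 hab had hbd (by linarith) (by linarith))
  · obtain ⟨a, b, c, hc, hmax, hlight, hmany⟩ := exists_light_center hG hdense
      (fun x y z => (third G x z).card ≤ (third G x y).card ∧
        (third G y z).card ≤ (third G x y).card)
      (fun x y z _ => by
        rw [third_comm G y x, third_comm G z x, third_comm G z y]; omega)
      (δ := 1 / 3) (by norm_num)
    wlog huv : (third G a c).card ≤ (third G b c).card generalizing a b
    · have hE : ∀ w, excess G m b a w = excess G m a b w := excess_swap G m a b
      refine this b a (third_comm G a b ▸ hc) ?_ ?_ ?_ (le_of_not_ge huv)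
      · rw [third_comm G b a]; exact hmax.symm
      · rwa [hE]
      · simpa only [hE, third_comm G b a] using hmany
    obtain ⟨hab, hac, hbc⟩ := hcod' hc
    rw [hex] at hlight
    have hDm : m < (third G a b).card := by
      by_contra! hD
      have key : ∀ {E : ℕ}, m < 3 * E → E ≤ (third G a b).card → (1 : ℝ) ≤ m / E :=
        fun h1 h2 => by
          simpa using div_le_div_of_mul_le (k := 1) (l := 1) (by omega) (by omega : _ ≤ 1 * m)
      have h1 := key hab le_rfl
      have h2 := key hac hmax.1
      have h3 := key hbc hmax.2
      linarith
    have hfin : ∀ d ∈ (third G a b).filter (fun w => excess G m a b w < 1 / 3), d ≠ c → ∀ u v,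
        u ≤ dprime G {a, b, c, d} a c → v ≤ dprime G {a, b, c, d} b c →
        demand T a₀ b₀ c₀ d₀ κ 1 + demand T a₀ b₀ c₀ d₀ κ 2 + demand T a₀ b₀ c₀ d₀ κ 3 +
          demand T a₀ b₀ c₀ d₀ κ 4 ≤ 2 * u + 1 →
        demand T a₀ b₀ c₀ d₀ κ 1 + demand T a₀ b₀ c₀ d₀ κ 2 + demand T a₀ b₀ c₀ d₀ κ 3 +
          demand T a₀ b₀ c₀ d₀ κ 4 ≤ v → ContainsCopy G T := by
      intro d hdY hdc u v hu hv hSu hSv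
      obtain ⟨hd, hdex⟩ := Finset.mem_filter.1 hdY
      obtain ⟨-, had, hbd⟩ := hcod' hd
      obtain ⟨h1, -, -, h4, h5⟩ := hdp hc hd
      rw [hex] at hdex
      have h0 : (0 : ℝ) ≤ m / (third G a b).card := by positivity
      exact h.containsCopy_of_canFit hG hc hd hdc.symm h1 hu hv h4 h5
        (canFit_of_large hm (by omega) (by omega) (by omega) hSu hSv had hbd (by linarith))
    by_cases hu : 2 * (third G a c).card ≤ demand T a₀ b₀ c₀ d₀ κ 1 + demand T a₀ b₀ c₀ d₀ κ 2 +
        demand T a₀ b₀ c₀ d₀ κ 3 + demand T a₀ b₀ c₀ d₀ κ 4 + 2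
    · obtain ⟨hv, hK⟩ := bounds_of_small_fst hm hac (by omega) huv hmax.2 (by linarith)
      obtain ⟨d, hdY, hdc, hd⟩ := exists_notMem_third hc hG (Finset.filter_subset _ _)
        (hmany _ (by rw [hex, neg_sub]; exact hK))
      have hd' := (Finset.mem_filter.1 hdY).1
      exact hfin d hdY hdc _ _ (card_third_sub_one_le_dprime hG hd) (hdp hc hd').2.2.1
        (by omega) (by omega)
    by_cases hv : demand T a₀ b₀ c₀ d₀ κ 1 + demand T a₀ b₀ c₀ d₀ κ 2 +
        demand T a₀ b₀ c₀ d₀ κ 3 + demand T a₀ b₀ c₀ d₀ κ 4 + 2 ≤ (third G b c).card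
    · have hY := hmany 1 (by
        have := three_sub_div_le' hm hDm
        have h1 : (0 : ℝ) ≤ m / (third G a c).card := by positivity
        have h2 : (0 : ℝ) ≤ m / (third G b c).card := by positivity
        rw [hex]
        push_cast
        linarith)
      obtain ⟨d, hdY, hdc⟩ := Finset.exists_mem_ne hY c
      have hd := (Finset.mem_filter.1 hdY).1
      exact hfin d hdY hdc _ _ (hdp hc hd).2.1 (hdp hc hd).2.2.1 (by omega) (by omega)
    · have hv' : 2 * m < 3 * (third G b c).card := by
        by_contra! h'
        have h1 := div_le_div_of_mul_le (k := 3) (l := 2) (by omega) (by omega :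
          3 * (third G a c).card ≤ 2 * m)
        have h2 := div_le_div_of_mul_le (k := 3) (l := 2) (by omega) h'
        norm_num at h1 h2
        have h0 : (0 : ℝ) ≤ m / (third G a b).card := by positivity
        linarith
      have hK := bounds_of_small_snd hm hac (by omega) huv hmax.2 (by linarith)
      obtain ⟨d, hdY, hdc, hd⟩ := exists_notMem_third (third_comm G a b ▸ hc) hG
        (third_comm G a b ▸ Finset.filter_subset _ _) (hmany _ (by rw [hex, neg_sub]; exact hK))
      have hd' := (Finset.mem_filter.1 hdY).1
      have hvd := card_third_sub_one_le_dprime (b := a) hG hd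
      rw [Finset.insert_comm] at hvd
      exact hfin d hdY hdc _ _ (hdp hc hd').2.1 hvd (by omega) (by omega)

lemma card_coveredPairs_le [Fintype V] [DecidableEq V] (G : Finset (Finset V)) :
    (coveredPairs G).card ≤ 2 * (Fintype.card V).choose 2 := by
  have h : coveredPairs G ⊆ (Finset.univ : Finset V).offDiag := by
    rintro ⟨x, y⟩ hxy
    simpa using (mem_coveredPairs.1 hxy).1
  refine (Finset.card_le_card h).trans ?_
  rw [Finset.offDiag_card, Finset.card_univ, Nat.choose_two_right,
    Nat.mul_div_cancel' (Nat.even_mul_pred_self _).two_dvd, Nat.mul_sub_one]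

/-- Kalai's conjecture for tight 3-trees with at least 20 edges and a trunk
of size at most 2. -/
theorem stmt0 {V : Type*} {W : Type*} [DecidableEq V] [Fintype W] [DecidableEq W]
    (T : Finset (Finset V)) (t : ℕ) (ht : 20 ≤ t) (hTt : T.card = t)
    (hT : IsTightTree 3 T)
    (hc : ∃ T', IsTrunk 3 T T' ∧ T'.card ≤ 2)
    (n : ℕ) (hn : Fintype.card W = n)
    (G : Finset (Finset W)) (hG : ∀ g ∈ G, g.card = 3)
    (hsize : ((t : ℝ) - 1) / 3 * (n.choose 2 : ℝ) < (G.card : ℝ)) :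
    ContainsCopy G T := by
  obtain ⟨a, b, c, d, ℓ, κ, h⟩ := exists_isTwoTrunk (by omega) hc
  obtain ⟨m, rfl⟩ : ∃ m, t = m + 1 := ⟨t - 1, by omega⟩
  have hdense : m * (coveredPairs G).card < 6 * G.card := by
    have hle : ((coveredPairs G).card : ℝ) ≤ 2 * n.choose 2 := by
      exact_mod_cast hn ▸ card_coveredPairs_le G
    have hm := mul_le_mul_of_nonneg_left hle m.cast_nonneg
    push_cast at hsize
    have : (m * (coveredPairs G).card : ℝ) < 6 * G.card := by linarith
    exact_mod_cast this
  obtain ⟨H, hHG, hH, hcod⟩ := exists_dense_subgraph hG hdense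
  obtain ⟨f, hf, hfH⟩ := h.containsCopy_of_dense (by omega) hTt (fun g hg => hG g (hHG hg)) hH hcod
  exact ⟨f, hf, fun e he => hHG (hfH e he)⟩
end

section
/- Let r ≥ 2 and c ≥ 1 be integers and set a(r,c) = (r^r + 1 − 1/r)(c − 1). Let T be a tight r-tree with t edges and c(T) ≤ c. Then ex_r(n, T) ≤ ((t−1)/r + a(r,c))·C(n, r−1) for every n. -/
open Finset

variable {V : Type*}

/-- An `r`-graph with more than `m` edges per shadow set contains a nonempty subgraph
in which every shadow set has codegree more than `m`. -/
theorem exists_subgraph_lt_degree [DecidableEq V] (G : Finset (Finset V)) (r m : ℕ)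
    (h : m * (hshadow G r).card < G.card) :
    ∃ H ⊆ G, H.Nonempty ∧ ∀ e ∈ H, ∀ D ∈ e.powersetCard (r - 1), m < degree H D := by
  induction G using Finset.strongInduction with
  | H G ih =>
    by_cases hall : ∀ e ∈ G, ∀ D ∈ e.powersetCard (r - 1), m < degree G D
    · exact ⟨G, Subset.rfl, card_pos.1 (by omega), hall⟩
    push Not at hall
    obtain ⟨e, he, D, hD, hdeg⟩ := hall
    have hDe := (mem_powersetCard.1 hD).1
    have hss : (G.filter fun e => ¬ D ⊆ e) ⊂ G :=
      filter_ssubset.2 ⟨e, he, by simpa using hDe⟩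
    have hsh : hshadow (G.filter fun e => ¬ D ⊆ e) r ⊆ (hshadow G r).erase D := by
      intro D' hD'
      simp only [hshadow, mem_biUnion, mem_filter, mem_erase] at hD' ⊢
      obtain ⟨f, ⟨hf, hDf⟩, hD'f⟩ := hD'
      refine ⟨?_, f, hf, hD'f⟩
      rintro rfl
      exact hDf (mem_powersetCard.1 hD'f).1
    have hDs : D ∈ hshadow G r := mem_biUnion.2 ⟨e, he, hD⟩
    have h1 := card_le_card hsh
    rw [card_erase_of_mem hDs] at h1
    have h2 : 0 < (hshadow G r).card := card_pos.2 ⟨D, hDs⟩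
    have h3 := card_filter_add_card_filter_not (s := G) (fun e => D ⊆ e)
    obtain ⟨H, hHG, hH⟩ := ih _ hss (by
      unfold degree at hdeg
      have h4 := Nat.mul_le_mul_left m h1
      rw [Nat.mul_sub, mul_one] at h4
      have h5 : m ≤ m * (hshadow G r).card := Nat.le_mul_of_pos_right _ h2
      omega)
    exact ⟨H, hHG.trans hss.subset, hH⟩

theorem card_hshadow_le [Fintype V] [DecidableEq V] (G : Finset (Finset V)) (r : ℕ) :
    (hshadow G r).card ≤ (Fintype.card V).choose (r - 1) := by
  rw [← card_univ, ← card_powersetCard]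
  refine card_le_card fun D hD => ?_
  obtain ⟨e, -, he⟩ := mem_biUnion.1 hD
  exact mem_powersetCard.2 ⟨subset_univ _, (mem_powersetCard.1 he).2⟩

theorem sum_weight_le [Fintype V] [DecidableEq V] (G : Finset (Finset V)) (r : ℕ) :
    ∑ e ∈ G, weight G r e ≤ ((Fintype.card V).choose (r - 1) : ℝ) := by
  have hcomm : ∑ e ∈ G, weight G r e =
      ∑ D ∈ hshadow G r, ∑ _e ∈ G.filter (fun e => D ⊆ e ∧ D.card = r - 1),
        (1 : ℝ) / (degree G D : ℝ) := by
    unfold weight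
    refine sum_comm' fun e D => ?_
    simp only [hshadow, mem_biUnion, mem_filter, mem_powersetCard]
    grind
  rw [hcomm]
  refine le_trans (sum_le_card_nsmul _ _ 1 fun D _ => ?_) ?_
  · rw [sum_const, nsmul_eq_mul, mul_one_div]
    refine div_le_one_of_le₀ ?_ (Nat.cast_nonneg _)
    refine Nat.cast_le.2 (card_le_card fun e he => ?_)
    obtain ⟨heG, hDe, -⟩ := mem_filter.1 he
    exact mem_filter.2 ⟨heG, hDe⟩
  · rw [nsmul_eq_mul, mul_one]
    exact_mod_cast card_hshadow_le G r

/-- Light edges, those of weight less than `1 / m`, are plentiful. -/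
theorem lt_card_light [Fintype V] [DecidableEq V] (G : Finset (Finset V)) (r : ℕ) {m x : ℝ}
    (hm : 0 ≤ m) (h : (m + x) * ((Fintype.card V).choose (r - 1) : ℝ) < G.card) :
    x * ((Fintype.card V).choose (r - 1) : ℝ) <
      ((G.filter fun e => m * weight G r e < 1).card : ℝ) := by
  have hw : ∀ e, 0 ≤ weight G r e := fun e => sum_nonneg fun D _ => by positivity
  have h1 : ((G.filter fun e => ¬ m * weight G r e < 1).card : ℝ) ≤
      m * ((Fintype.card V).choose (r - 1) : ℝ) := by
    calc _ = ∑ e ∈ G.filter (fun e => ¬ m * weight G r e < 1), (1 : ℝ) := by simp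
      _ ≤ ∑ e ∈ G.filter (fun e => ¬ m * weight G r e < 1), m * weight G r e :=
        sum_le_sum fun e he => not_lt.1 (mem_filter.1 he).2
      _ ≤ ∑ e ∈ G, m * weight G r e :=
        sum_le_sum_of_subset_of_nonneg (filter_subset _ _) fun e _ _ => mul_nonneg hm (hw e)
      _ ≤ _ := by
        rw [← mul_sum]
        exact mul_le_mul_of_nonneg_left (sum_weight_le G r) hm
  have h2 : ((G.filter fun e => m * weight G r e < 1).card : ℝ) +
      ((G.filter fun e => ¬ m * weight G r e < 1).card : ℝ) = G.card := by
    exact_mod_cast card_filter_add_card_filter_not (s := G) (fun e => m * weight G r e < 1)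
  linarith

/-- A colouring that is injective on `e` and orders `e` by the values of `h`. -/
def Sorts {r : ℕ} (χ : V → Fin r) (h : V → ℕ) (e : Finset V) : Prop :=
  Set.InjOn χ e ∧ ∀ u ∈ e, ∀ v ∈ e, χ u ≤ χ v → h u ≤ h v

theorem exists_sorts [DecidableEq V] {r : ℕ} (hr : 0 < r) (h : V → ℕ) (e : Finset V)
    (he : e.card = r) : ∃ χ : V → Fin r, Sorts χ h e := by
  let φ := (e.equivFinOfCardEq he).symm
  let σ := Tuple.sort fun i => h (φ i)
  have hσ : Monotone fun i => h (φ (σ i)) := Tuple.monotone_sort fun i => h (φ i)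
  refine ⟨fun u => if hu : u ∈ e then σ.symm (φ.symm ⟨u, hu⟩) else ⟨0, hr⟩, ?_, ?_⟩
  · intro u hu v hv huv
    rw [mem_coe] at hu hv
    simpa [hu, hv] using huv
  · intro u hu v hv huv
    simp only [hu, hv, dite_true] at huv
    simpa using hσ huv

/-- A positive proportion of all colourings sorts a given edge. -/
theorem pow_le_card_sorts [Fintype V] [DecidableEq V] {r : ℕ} (hr : 0 < r) (h : V → ℕ)
    (e : Finset V) (he : e.card = r) [DecidablePred fun χ : V → Fin r => Sorts χ h e] :
    r ^ Fintype.card V ≤ r ^ r * (univ.filter fun χ : V → Fin r => Sorts χ h e).card := by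
  obtain ⟨χ₀, h₀, h₁⟩ := exists_sorts hr h e he
  have hsub : Fintype.piFinset (fun w => if w ∈ e then {χ₀ w} else univ) ⊆
      univ.filter fun χ : V → Fin r => Sorts χ h e := by
    intro χ hχ
    have hχe : ∀ w ∈ e, χ w = χ₀ w := fun w hw => by
      simpa [hw] using Fintype.mem_piFinset.1 hχ w
    refine mem_filter.2 ⟨mem_univ _, fun u hu v hv huv => h₀ hu hv ?_, fun u hu v hv huv => ?_⟩
    · rwa [hχe u hu, hχe v hv] at huv
    · rw [hχe u hu, hχe v hv] at huv
      exact h₁ u hu v hv huv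
  have hcard : (Fintype.piFinset (fun w => if w ∈ e then {χ₀ w} else univ)).card =
      r ^ (Fintype.card V - r) := by
    rw [Fintype.card_piFinset]
    have : ∀ w, (if w ∈ e then ({χ₀ w} : Finset (Fin r)) else univ).card =
        if w ∈ e then 1 else r := fun w => by split_ifs <;> simp
    simp only [this]
    rw [prod_ite]
    simp [filter_not, card_sdiff, he]
  have hle : r ≤ Fintype.card V := he ▸ card_le_univ e
  calc r ^ Fintype.card V = r ^ r * r ^ (Fintype.card V - r) := by
        rw [← pow_add, Nat.add_sub_cancel' hle]
    _ ≤ _ := Nat.mul_le_mul_left _ (hcard ▸ card_le_card hsub)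

/-- Some colouring sorts many edges at once. -/
theorem exists_coloring_card_sorts [Fintype V] [DecidableEq V] {r : ℕ} (hr : 0 < r)
    (h : Finset V → V → ℕ) (G : Finset (Finset V)) (hG : ∀ e ∈ G, e.card = r) :
    ∃ χ : V → Fin r, ∃ H ⊆ G, (∀ e ∈ H, Sorts χ (h e) e) ∧ G.card ≤ r ^ r * H.card := by
  classical
  by_contra! hcon
  have h1 : ∑ χ : V → Fin r, r ^ r * (G.filter fun e => Sorts χ (h e) e).card <
      ∑ _χ : V → Fin r, G.card := by
    refine sum_lt_sum_of_nonempty ⟨fun _ => ⟨0, hr⟩, mem_univ _⟩ fun χ _ => ?_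
    exact hcon χ _ (filter_subset _ _) fun e he => (mem_filter.1 he).2
  have h2 : ∑ χ : V → Fin r, (G.filter fun e => Sorts χ (h e) e).card =
      ∑ e ∈ G, (univ.filter fun χ : V → Fin r => Sorts χ (h e) e).card := by
    simp only [card_filter]
    exact sum_comm
  rw [← mul_sum, h2, mul_sum] at h1
  have h3 := sum_le_sum fun e he => pow_le_card_sorts hr (h e) e (hG e he)
  simp only [sum_const, card_univ, Fintype.card_fun, Fintype.card_fin, smul_eq_mul] at h1 h3
  rw [mul_comm] at h1
  omega

/-- The initial sums of a monotone sequence are at most proportional. -/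
theorem mul_sum_filter_le {r : ℕ} (A : Fin r → ℕ) (hA : Monotone A) (k : Fin r) :
    r * ∑ i ∈ univ.filter (· ≤ k), A i ≤ (k + 1) * ∑ i, A i := by
  have h1 : ∑ i ∈ univ.filter (· ≤ k), A i ≤ (k + 1) * A k := by
    refine (sum_le_card_nsmul _ _ (A k) fun i hi => hA (mem_filter.1 hi).2).trans ?_
    rw [filter_ge_eq_Iic, Fin.card_Iic, smul_eq_mul]
  have h2 : (r - 1 - k) * A k ≤ ∑ i ∈ univ.filter (¬ · ≤ k), A i := by
    refine le_trans ?_ (card_nsmul_le_sum _ _ (A k) fun i hi =>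
      hA (not_le.1 (mem_filter.1 hi).2).le)
    simp only [not_le, filter_lt_eq_Ioi]
    rw [Fin.card_Ioi, smul_eq_mul]
  rw [← sum_filter_add_sum_filter_not univ (· ≤ k) A]
  obtain ⟨q, hq⟩ := Nat.exists_eq_add_of_lt k.2
  have hq' : r - 1 - k = q := by omega
  rw [hq'] at h2
  generalize ∑ i ∈ univ.filter (· ≤ k), A i = S at *
  generalize ∑ i ∈ univ.filter (¬ · ≤ k), A i = R at *
  have h3 := Nat.mul_le_mul_left q h1
  have h4 := Nat.mul_le_mul_left (k + 1 : ℕ) h2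
  have h5 : r * S = q * S + (k + 1) * S := by
    rw [← add_mul]
    congr 1
    omega
  nlinarith

/-- In a light edge with sorted codegrees, the codegree of the `k`-th facet is large. -/
theorem mul_lt_degree_erase [DecidableEq V] {G : Finset (Finset V)} {r : ℕ} {m : ℝ} (hm : 0 ≤ m)
    {χ : V → Fin r} {e : Finset V} (heG : e ∈ G) (he : e.card = r)
    (hχ : Sorts χ (fun u => degree G (e.erase u)) e)
    (hlight : m * weight G r e < 1) {u : V} (hu : u ∈ e) :
    ((χ u : ℕ) + 1 : ℝ) * m < degree G (e.erase u) := by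
  have hpos : ∀ x, 0 < degree G (e.erase x) := fun x =>
    card_pos.2 ⟨e, mem_filter.2 ⟨heG, erase_subset _ _⟩⟩
  have himg : e.image χ = univ := by
    apply eq_univ_of_card
    rw [card_image_of_injOn hχ.1, he, Fintype.card_fin]
  have hcard : (e.filter fun x => χ x ≤ χ u).card = (χ u : ℕ) + 1 := by
    rw [← card_image_of_injOn (f := χ) (hχ.1.mono fun x hx => (mem_filter.1 hx).1),
      ← Fin.card_Iic (χ u)]
    congr 1
    ext k
    simp only [mem_image, mem_filter, mem_Iic]
    constructor
    · rintro ⟨x, ⟨-, hx⟩, rfl⟩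
      exact hx
    · intro hk
      obtain ⟨x, hx, rfl⟩ := mem_image.1 (himg ▸ mem_univ k)
      exact ⟨x, ⟨hx, hk⟩, rfl⟩
  have hinj : Set.InjOn e.erase (e.filter fun x => χ x ≤ χ u) := fun x hx y hy hxy =>
    (erase_inj _ (mem_filter.1 hx).1).1 hxy
  have hw : ((χ u : ℕ) + 1 : ℝ) * (1 / degree G (e.erase u)) ≤ weight G r e := by
    calc _ = ∑ x ∈ e.filter (fun x => χ x ≤ χ u), (1 : ℝ) / degree G (e.erase u) := by
          rw [sum_const, hcard, nsmul_eq_mul]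
          push_cast
          rfl
      _ ≤ ∑ x ∈ e.filter (fun x => χ x ≤ χ u), (1 : ℝ) / degree G (e.erase x) := by
          refine sum_le_sum fun x hx => ?_
          obtain ⟨hxe, hxu⟩ := mem_filter.1 hx
          refine one_div_le_one_div_of_le (by exact_mod_cast hpos x) ?_
          exact_mod_cast hχ.2 x hxe u hu hxu
      _ = ∑ D ∈ (e.filter fun x => χ x ≤ χ u).image e.erase, (1 : ℝ) / degree G D :=
          (sum_image (f := fun D => (1 : ℝ) / degree G D) hinj).symm
      _ ≤ weight G r e := by
          refine sum_le_sum_of_subset_of_nonneg ?_ fun _ _ _ => by positivity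
          intro D hD
          obtain ⟨x, hx, rfl⟩ := mem_image.1 hD
          rw [mem_powersetCard, card_erase_of_mem (mem_filter.1 hx).1, he]
          exact ⟨erase_subset _ _, rfl⟩
  have hd : (0 : ℝ) < degree G (e.erase u) := by exact_mod_cast hpos u
  have h1 := (mul_le_mul_of_nonneg_left hw hm).trans_lt hlight
  rw [mul_one_div, mul_div_assoc', div_lt_one hd] at h1
  linarith

/-- `v i` is the vertex that the `i`-th edge of the ordering `e` adds to the earlier ones. -/
def IsNewVertex [DecidableEq V] (e : ℕ → Finset V) (s : ℕ) (v : ℕ → V) : Prop :=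
  ∀ i, 0 < i → i < s → v i ∈ e i ∧ (∀ j < i, v i ∉ e j) ∧ ∃ j < i, (e i).erase (v i) ⊆ e j

theorem IsNewVertex.mono [DecidableEq V] {e : ℕ → Finset V} {s p : ℕ} {v : ℕ → V}
    (hv : IsNewVertex e s v) (hp : p ≤ s) : IsNewVertex e p v :=
  fun i h0 hi => hv i h0 (hi.trans_le hp)

theorem IsNewVertex.injOn [DecidableEq V] {e : ℕ → Finset V} {s : ℕ} {v : ℕ → V}
    (hv : IsNewVertex e s v) : Set.InjOn e (range s) := by
  have key : ∀ i < s, ∀ j < i, e i ≠ e j := fun i hi j hj h =>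
    (hv i (by omega) hi).2.1 j hj (h ▸ (hv i (by omega) hi).1)
  intro i hi j hj hij
  simp only [coe_range, Set.mem_Iio] at hi hj
  rcases lt_trichotomy i j with h | h | h
  · exact (key j hj i h hij.symm).elim
  · exact h
  · exact (key i hi j h hij).elim

theorem IsNewVertex.card_biUnion_le [DecidableEq V] {e : ℕ → Finset V} {s r : ℕ} {v : ℕ → V}
    (hv : IsNewVertex e s v) (he : ∀ i < s, (e i).card = r) (p : ℕ) (hp : p < s) :
    ((range (p + 1)).biUnion e).card ≤ r + p := by
  induction p with
  | zero => simp [he 0 hp]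
  | succ p ih =>
    obtain ⟨-, -, j, hj, hsub⟩ := hv (p + 1) (by omega) hp
    have h1 : (range (p + 1 + 1)).biUnion e ⊆ insert (v (p + 1)) ((range (p + 1)).biUnion e) := by
      rw [range_add_one, biUnion_insert]
      refine union_subset ?_ (subset_insert _ _)
      rw [← erase_subset_iff_of_mem (mem_insert_self _ _)]
      · refine hsub.trans (subset_trans ?_ (subset_insert _ _))
        exact subset_biUnion_of_mem e (mem_range.2 hj)
    have h2 := (card_le_card h1).trans (card_insert_le _ _)
    have h3 := ih (by omega)
    omega

/-- A tight tree is `r`-partite. -/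
theorem IsNewVertex.exists_coloring [DecidableEq V] {e : ℕ → Finset V} {s r : ℕ} {v : ℕ → V}
    (hr : 0 < r) (hv : IsNewVertex e s v) (he : ∀ i < s, (e i).card = r) :
    ∃ κ : V → Fin r, ∀ i < s, Set.InjOn κ (e i) := by
  induction s with
  | zero => exact ⟨fun _ => ⟨0, hr⟩, by simp⟩
  | succ s ih =>
    obtain ⟨κ, hκ⟩ := ih (hv.mono s.le_succ) fun i hi => he i (by omega)
    rcases Nat.eq_zero_or_pos s with rfl | hs
    · obtain ⟨χ, hχ⟩ := exists_sorts hr (fun _ => 0) (e 0) (he 0 one_pos)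
      refine ⟨χ, fun i hi => ?_⟩
      obtain rfl : i = 0 := by omega
      exact hχ.1
    obtain ⟨hvs, hnew, j, hj, hsub⟩ := hv s hs s.lt_succ_self
    obtain ⟨a, ha⟩ : ∃ a, a ∉ ((e s).erase (v s)).image κ := by
      by_contra! hcon
      have h1 := card_image_le (f := κ) (s := (e s).erase (v s))
      rw [eq_univ_of_forall hcon, card_univ, Fintype.card_fin, card_erase_of_mem hvs,
        he s s.lt_succ_self] at h1
      omega
    have hupd : ∀ x, x ≠ v s → Function.update κ (v s) a x = κ x := fun x hx =>
      Function.update_of_ne hx _ _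
    refine ⟨Function.update κ (v s) a, fun i hi => ?_⟩
    rcases Nat.lt_succ_iff_lt_or_eq.1 hi with hi | rfl
    · intro x hx y hy hxy
      rw [hupd x (fun h => hnew i hi (h ▸ hx)), hupd y (fun h => hnew i hi (h ▸ hy))] at hxy
      exact hκ i hi hx hy hxy
    · rw [← insert_erase hvs, coe_insert, Set.injOn_insert (by simp)]
      refine ⟨fun x hx y hy hxy => ?_, ?_⟩
      · have hx' := mem_erase.1 (mem_coe.1 hx)
        have hy' := mem_erase.1 (mem_coe.1 hy)
        rw [hupd x hx'.1, hupd y hy'.1] at hxy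
        exact hκ j hj (hsub hx) (hsub hy) hxy
      · rintro ⟨x, hx, hxa⟩
        rw [hupd x (mem_erase.1 (mem_coe.1 hx)).1, Function.update_self] at hxa
        exact ha (mem_image.2 ⟨x, hx, hxa⟩)

/-- The vertices of `V` outside `U` completing `D` to an edge number at least the codegree of `D`
minus the size of `U` outside `D`. -/
theorem degree_le_card_add [Fintype V] [DecidableEq V] {G : Finset (Finset V)} {r : ℕ}
    (hr : 0 < r) (hG : ∀ e ∈ G, e.card = r) {D U : Finset V} (hD : D.card = r - 1) (hDU : D ⊆ U) :
    degree G D + (r - 1) ≤ (univ.filter fun w => w ∉ U ∧ insert w D ∈ G).card + U.card := by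
  have h1 : G.filter (fun e => D ⊆ e) ⊆
      ((univ.filter fun w => w ∉ U ∧ insert w D ∈ G) ∪ (U \ D)).image fun w => insert w D := by
    intro e he
    obtain ⟨heG, hDe⟩ := mem_filter.1 he
    obtain ⟨w, hw⟩ : ∃ w, e \ D = {w} := by
      rw [← card_eq_one, card_sdiff_of_subset hDe, hG e heG]
      omega
    have hwe : insert w D = e := by
      rw [insert_eq, ← hw, sdiff_union_of_subset hDe]
    have hwD : w ∉ D := (mem_sdiff.1 (hw ▸ mem_singleton_self w : w ∈ e \ D)).2
    refine mem_image.2 ⟨w, ?_, hwe⟩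
    by_cases hwU : w ∈ U
    · exact mem_union_right _ (mem_sdiff.2 ⟨hwU, hwD⟩)
    · exact mem_union_left _ (mem_filter.2 ⟨mem_univ _, hwU, hwe.symm ▸ heG⟩)
  have h2 := (card_le_card h1).trans (card_image_le.trans (card_union_le _ _))
  have h3 := card_le_card hDU
  rw [card_sdiff_of_subset hDU] at h2
  unfold degree
  omega

/-- A tight tree with `s ≤ c` edges embeds, respecting colours, into an `r`-partite `r`-graph all
of whose shadow sets have codegree at least `c`. -/
theorem IsNewVertex.exists_embedding {W : Type*} [DecidableEq V] [Fintype W] [DecidableEq W]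
    {e : ℕ → Finset V} {s r c : ℕ} {v : ℕ → V} (hr : 0 < r) (hs : 0 < s) (hsc : s ≤ c)
    (hv : IsNewVertex e s v) (he : ∀ i < s, (e i).card = r)
    {κ : V → Fin r} (hκ : ∀ i < s, Set.InjOn κ (e i))
    {H : Finset (Finset W)} (hne : H.Nonempty) (hH : ∀ g ∈ H, g.card = r)
    {χ : W → Fin r} (hχ : ∀ g ∈ H, Set.InjOn χ g)
    (hdeg : ∀ g ∈ H, ∀ D ∈ g.powersetCard (r - 1), c ≤ degree H D) :
    ∃ f : V → W, Set.InjOn f ((range s).biUnion e) ∧ (∀ i < s, (e i).image f ∈ H) ∧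
      ∀ x ∈ (range s).biUnion e, χ (f x) = κ x := by
  have himg : ∀ g ∈ H, ∀ k, ∃ w ∈ g, χ w = k := by
    intro g hg k
    have : g.image χ = univ := by
      apply eq_univ_of_card
      rw [card_image_of_injOn (hχ g hg), hH g hg, Fintype.card_fin]
    exact mem_image.1 (this ▸ mem_univ k)
  induction s with
  | zero => omega
  | succ s ih =>
    rcases Nat.eq_zero_or_pos s with rfl | hs0
    · obtain ⟨g, hg⟩ := hne
      choose ψ hψ hψχ using himg g hg
      have hinj : Set.InjOn (fun x => ψ (κ x)) (e 0) := fun x hx y hy hxy =>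
        hκ 0 one_pos hx hy (by rw [← hψχ (κ x), ← hψχ (κ y)]; exact congrArg χ hxy)
      refine ⟨fun x => ψ (κ x), ?_, fun i hi => ?_, fun x _ => hψχ _⟩
      · simpa using hinj
      · obtain rfl : i = 0 := by omega
        have : (e 0).image (fun x => ψ (κ x)) = g := by
          refine eq_of_subset_of_card_le (image_subset_iff.2 fun x _ => hψ _) ?_
          rw [card_image_of_injOn hinj, he 0 one_pos, hH g hg]
        exact this ▸ hg
    obtain ⟨f, hf, hfH, hfχ⟩ := ih hs0 (by omega) (hv.mono s.le_succ)
      (fun i hi => he i (by omega)) fun i hi => hκ i (by omega)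
    obtain ⟨hvs, hnew, j, hj, hsub⟩ := hv s hs0 s.lt_succ_self
    set U := (range s).biUnion e with hU
    set D := (e s).erase (v s) with hD
    have hjU : e j ⊆ U := subset_biUnion_of_mem e (mem_range.2 hj)
    have hDcard : D.card = r - 1 := by rw [hD, card_erase_of_mem hvs, he s s.lt_succ_self]
    have hfD : (D.image f).card = r - 1 := by
      rw [card_image_of_injOn (hf.mono fun x hx => hjU (hsub hx)), hDcard]
    have hvU : v s ∉ U := by
      simp only [hU, mem_biUnion, mem_range, not_exists, not_and]
      exact hnew
    have hUcard : U.card ≤ r + (s - 1) := by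
      have := hv.card_biUnion_le he (s - 1) (by omega)
      rwa [Nat.sub_add_cancel hs0] at this
    have hcount := degree_le_card_add hr hH hfD
      (image_subset_image (f := f) (hsub.trans hjU))
    have hc := hdeg _ (hfH j hj) (D.image f) (mem_powersetCard.2 ⟨image_subset_image hsub, hfD⟩)
    have hfU : (U.image f).card ≤ U.card := card_image_le
    obtain ⟨w, hw⟩ : (univ.filter fun w => w ∉ U.image f ∧ insert w (D.image f) ∈ H).Nonempty :=
      card_pos.1 (by omega)
    obtain ⟨-, hwU, hwH⟩ := mem_filter.1 hw
    have hupd : ∀ x ∈ U, Function.update f (v s) w x = f x := fun x hx =>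
      Function.update_of_ne (ne_of_mem_of_not_mem hx hvU) _ _
    have hes : insert (v s) D = e s := insert_erase hvs
    have hUs : (range (s + 1)).biUnion e = insert (v s) U := by
      rw [range_add_one, biUnion_insert, ← hU, ← hes, insert_union,
        union_eq_right.2 (hsub.trans hjU)]
    have hcol : χ w = κ (v s) := by
      obtain ⟨y, hy, hyk⟩ := himg _ hwH (κ (v s))
      rcases mem_insert.1 hy with rfl | hy
      · exact hyk
      obtain ⟨x, hx, rfl⟩ := mem_image.1 hy
      rw [hfχ x (hjU (hsub hx))] at hyk
      have := hκ s s.lt_succ_self (mem_of_mem_erase hx) hvs hyk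
      exact ((mem_erase.1 hx).1 this).elim
    refine ⟨Function.update f (v s) w, ?_, fun i hi => ?_, fun x hx => ?_⟩
    · rw [hUs, coe_insert, Set.injOn_insert (by simpa using hvU)]
      refine ⟨fun x hx y hy hxy => ?_, ?_⟩
      · rw [hupd x hx, hupd y hy] at hxy
        exact hf hx hy hxy
      · rintro ⟨x, hx, hxw⟩
        rw [hupd x hx, Function.update_self] at hxw
        exact hwU (mem_image.2 ⟨x, hx, hxw⟩)
    · rcases Nat.lt_succ_iff_lt_or_eq.1 hi with hi | rfl
      · rw [image_congr (g := f) fun x hx => hupd x (subset_biUnion_of_mem e (mem_range.2 hi) hx)]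
        exact hfH i hi
      · rw [← hes, image_insert, Function.update_self,
          image_congr (g := f) fun x hx => hupd x (hjU (hsub hx))]
        exact hwH
    · rw [hUs] at hx
      rcases mem_insert.1 hx with rfl | hx
      · rw [Function.update_self, hcol]
      · rw [hupd x hx, hfχ x hx]

/-- Every edge outside the trunk is attached to an edge of the trunk. -/
theorem IsNewVertex.exists_trunk_edge [DecidableEq V] {e : ℕ → Finset V} {s p : ℕ} {v : ℕ → V}
    (hp : 0 < p) (hv : IsNewVertex e s v)
    (hleaf : ∀ i, p ≤ i → i < s → IsLeaf ((range s).image e) (v i))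
    (i : ℕ) (hpi : p ≤ i) (his : i < s) : ∃ j < p, (e i).erase (v i) ⊆ e j := by
  induction i using Nat.strong_induction_on with
  | _ i ih =>
    obtain ⟨hvi, -, j, hj, hsub⟩ := hv i (by omega) his
    rcases lt_or_ge j p with hjp | hjp
    · exact ⟨j, hjp, hsub⟩
    obtain ⟨k, hk, hjk⟩ := ih j hj hjp (by omega)
    refine ⟨k, hk, fun x hx => hjk (mem_erase.2 ⟨?_, hsub hx⟩)⟩
    rintro rfl
    have hmem : ∀ l < s, v j ∈ e l → e l ∈ ((range s).image e).filter fun g => v j ∈ g :=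
      fun l hl h => mem_filter.2 ⟨mem_image_of_mem e (mem_range.2 hl), h⟩
    have heq := card_le_one.1 (hleaf j hjp (by omega)).le _ (hmem i his (mem_of_mem_erase hx)) _
      (hmem j (by omega) (hv j (by omega) (by omega)).1)
    have := hv.injOn (mem_coe.2 (mem_range.2 his)) (mem_coe.2 (mem_range.2 (by omega))) heq
    omega

/-- A proper `r`-colouring of a tight tree can be chosen so that the numbers of leaves outside the
trunk increase with the colour. -/
theorem IsNewVertex.exists_sorted_coloring [DecidableEq V] {e : ℕ → Finset V} {s r : ℕ} {v : ℕ → V}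
    (hr : 0 < r) (hv : IsNewVertex e s v) (he : ∀ i < s, (e i).card = r) (L : Finset ℕ) :
    ∃ κ : V → Fin r, (∀ i < s, Set.InjOn κ (e i)) ∧
      Monotone fun k => (L.filter fun i => κ (v i) = k).card := by
  obtain ⟨κ, hκ⟩ := hv.exists_coloring hr he
  let A : Fin r → ℕ := fun k => (L.filter fun i => κ (v i) = k).card
  refine ⟨fun x => (Tuple.sort A).symm (κ x), fun i hi => ?_, ?_⟩
  · exact (Tuple.sort A).symm.injective.comp_injOn (hκ i hi)
  · simp only [Equiv.symm_apply_eq]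
    exact Tuple.monotone_sort A

/-- asymptotic version of Kalai's conjecture for tight `r`-trees with a trunk
of size at most `c`, with error term `a(r,c) = (r^r + 1 - 1/r)(c - 1)`. -/
theorem stmt3 {V : Type*} {W : Type*} [DecidableEq V] [Fintype W] [DecidableEq W]
    (r c t : ℕ) (hr : 2 ≤ r) (hc : 1 ≤ c)
    (T : Finset (Finset V)) (hTt : T.card = t)
    (hT : IsTightTree r T)
    (htrunk : ∃ T', IsTrunk r T T' ∧ T'.card ≤ c)
    (n : ℕ) (hn : Fintype.card W = n)
    (G : Finset (Finset W)) (hG : ∀ g ∈ G, g.card = r)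
    (hsize : (((t : ℝ) - 1) / (r : ℝ) + ((r : ℝ) ^ r + 1 - 1 / (r : ℝ)) * ((c : ℝ) - 1))
        * (n.choose (r - 1) : ℝ) < (G.card : ℝ)) :
    ContainsCopy G T := by
  obtain ⟨T', ⟨e, s, p₀, hps₀, ⟨rfl, he, hprop⟩, rfl, hleaf₀⟩, hT'c⟩ := htrunk
  rcases Nat.eq_zero_or_pos s with rfl | hs
  · rcases isEmpty_or_nonempty W with hW | hW
    · rw [← hn, Fintype.card_eq_zero, Nat.choose_eq_zero_of_lt (by omega)] at hsize
      have : G = ∅ := eq_empty_of_forall_notMem fun g hg => by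
        have := hG g hg
        rw [eq_empty_of_isEmpty g, card_empty] at this
        omega
      simp [this] at hsize
    · exact ⟨fun _ => Classical.arbitrary W, by simp, by simp⟩
  have hr0 : 0 < r := by omega
  obtain ⟨x₀, -⟩ : (e 0).Nonempty := card_pos.1 (by rw [he 0 hs]; exact hr0)
  have hex : ∀ i, ∃ x, 0 < i → i < s →
      x ∈ e i ∧ (∀ j < i, x ∉ e j) ∧ ∃ j < i, (e i).erase x ⊆ e j := by
    intro i
    by_cases hi : 0 < i ∧ i < s
    · obtain ⟨x, hx⟩ := hprop i hi.1 hi.2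
      exact ⟨x, fun _ _ => hx⟩
    · exact ⟨x₀, fun h1 h2 => (hi ⟨h1, h2⟩).elim⟩
  choose v hv' using hex
  have hv : IsNewVertex e s v := hv'
  have hst : s = t := by rw [← hTt, card_image_of_injOn hv.injOn, card_range]
  subst hst
  have hp₀c : p₀ ≤ c := by
    rwa [card_image_of_injOn (hv.mono hps₀).injOn, card_range] at hT'c
  -- An empty trunk may be replaced by the first edge.
  obtain ⟨p, hp, hps, hpc, hp₀p⟩ : ∃ p, 0 < p ∧ p ≤ s ∧ p ≤ c ∧ p₀ ≤ p :=
    ⟨max p₀ 1, by omega, by omega, by omega, by omega⟩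
  have hleaf : ∀ i, p ≤ i → i < s → IsLeaf ((range s).image e) (v i) := by
    intro i hpi his
    obtain ⟨hvi, hnew, -⟩ := hv i (by omega) his
    refine hleaf₀ _ (mem_biUnion.2 ⟨e i, mem_image_of_mem e (mem_range.2 his), hvi⟩) ?_
    simp only [image_biUnion, mem_biUnion, mem_range, not_exists, not_and]
    exact fun j hj => hnew j (by omega)
  have hpR : (1 : ℝ) ≤ p := by exact_mod_cast hp
  have hpcR : (p : ℝ) ≤ c := by exact_mod_cast hpc
  have hpsR : (p : ℝ) ≤ s := by exact_mod_cast hps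
  have hrR : (1 : ℝ) ≤ r := by exact_mod_cast hr0
  have hr1 : 1 / (r : ℝ) ≤ 1 := by rw [div_le_one (by linarith)]; exact hrR
  set m : ℝ := ((s : ℝ) - 1) / r + (1 - 1 / (r : ℝ)) * ((c : ℝ) - 1) with hm_def
  have hm : 0 ≤ m := add_nonneg (div_nonneg (by linarith) (by linarith))
    (mul_nonneg (by linarith) (by linarith))
  have hlight := lt_card_light G r (m := m) (x := (r : ℝ) ^ r * ((c : ℝ) - 1)) hm (by
    rw [hn]
    refine lt_of_eq_of_lt ?_ hsize
    rw [hm_def]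
    ring)
  obtain ⟨χ, H₁, hH₁, hsort, hcard⟩ := exists_coloring_card_sorts hr0
    (fun g u => degree G (g.erase u)) (G.filter fun g => m * weight G r g < 1)
    fun g hg => hG g (mem_filter.1 hg).1
  have hH₁card : (c - 1) * (hshadow H₁ r).card < H₁.card := by
    have h1 : ((r : ℝ) ^ r) * (((c : ℝ) - 1) * ((Fintype.card W).choose (r - 1) : ℝ)) <
        (r : ℝ) ^ r * (H₁.card : ℝ) := by
      rw [← mul_assoc]
      exact hlight.trans_le (by exact_mod_cast hcard)
    have h2 := lt_of_mul_lt_mul_left h1 (by positivity)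
    have h3 : (c - 1) * (Fintype.card W).choose (r - 1) < H₁.card := by
      have : ((c - 1 : ℕ) : ℝ) = (c : ℝ) - 1 := by push_cast [hc]; rfl
      rw [← this] at h2
      exact_mod_cast h2
    exact (Nat.mul_le_mul_left _ (card_hshadow_le H₁ r)).trans_lt h3
  obtain ⟨H, hHH₁, hne, hdeg⟩ := exists_subgraph_lt_degree H₁ r (c - 1) hH₁card
  have hHG : ∀ g ∈ H, g ∈ G ∧ m * weight G r g < 1 := fun g hg => mem_filter.1 (hH₁ (hHH₁ hg))
  let L := Ico p s
  obtain ⟨κ, hκ, hmono⟩ := hv.exists_sorted_coloring hr0 he L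
  obtain ⟨f, hf, hfH, hfχ⟩ := (hv.mono hps).exists_embedding hr0 hp hpc
    (fun i hi => he i (by omega)) (fun i hi => hκ i (by omega)) hne
    (fun g hg => hG g (hHG g hg).1) (fun g hg => (hsort g (hHH₁ hg)).1)
    (fun g hg D hD => by have := hdeg g hg D hD; omega)
  set U := (range p).biUnion e with hU
  have hUcard : U.card ≤ r + (p - 1) := by
    have := hv.card_biUnion_le he (p - 1) (by omega)
    rwa [Nat.sub_add_cancel hp] at this
  have htrunk := hv.exists_trunk_edge hp hleaf
  have hvU : ∀ i ∈ L, v i ∉ U := by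
    intro i hi
    obtain ⟨hpi, his⟩ := mem_Ico.1 hi
    simp only [hU, mem_biUnion, mem_range, not_exists, not_and]
    exact fun j hj => (hv i (by omega) his).2.1 j (by omega)
  let N : ℕ → Finset W := fun i =>
    univ.filter fun w => w ∉ U.image f ∧ insert w (((e i).erase (v i)).image f) ∈ G
  have hN : ∀ i ∈ L, (L.filter fun j => κ (v j) ≤ κ (v i)).card ≤ (N i).card := by
    intro i hi
    obtain ⟨hpi, his⟩ := mem_Ico.1 hi
    obtain ⟨j, hj, hsub⟩ := htrunk i hpi his
    have hvi := (hv i (by omega) his).1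
    have hjU : e j ⊆ U := subset_biUnion_of_mem e (mem_range.2 hj)
    have hDcard : ((e i).erase (v i)).card = r - 1 := by
      rw [card_erase_of_mem hvi, he i his]
    have hfD : (((e i).erase (v i)).image f).card = r - 1 := by
      rw [card_image_of_injOn (hf.mono fun x hx => hjU (hsub hx)), hDcard]
    have hcount := degree_le_card_add hr0 hG hfD
      (image_subset_image (f := f) (hsub.trans hjU))
    have hfU : (U.image f).card ≤ U.card := card_image_le
    have hgH := hfH j hj
    have hgcard := hG _ (hHG _ hgH).1
    -- The edge `e j` of the trunk has a vertex of the same colour as the leaf `v i`.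
    obtain ⟨u, hu, hur⟩ : ∃ u ∈ (e j).image f, ((e j).image f).erase u =
        ((e i).erase (v i)).image f := by
      obtain ⟨u, hu⟩ : ∃ u, (e j).image f \ ((e i).erase (v i)).image f = {u} := by
        rw [← card_eq_one, card_sdiff_of_subset (image_subset_image hsub), hgcard, hfD]
        omega
      refine ⟨u, (mem_sdiff.1 (hu ▸ mem_singleton_self u)).1, ?_⟩
      rw [erase_eq, ← hu, Finset.sdiff_sdiff_eq_self (image_subset_image hsub)]
    have hχu : χ u = κ (v i) := by
      have himg : (e i).image κ = univ := by
        apply eq_univ_of_card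
        rw [card_image_of_injOn (hκ i his), he i his, Fintype.card_fin]
      obtain ⟨x, hx, hxu⟩ := mem_image.1 (himg ▸ mem_univ (χ u))
      by_cases hxv : x = v i
      · rw [← hxu, hxv]
      have hxD : x ∈ (e i).erase (v i) := mem_erase.2 ⟨hxv, hx⟩
      have hfx : f x ∈ ((e j).image f).erase u := hur ▸ mem_image_of_mem f hxD
      rw [← hfχ x (hjU (hsub hxD))] at hxu
      exact ((mem_erase.1 hfx).1
        ((hsort _ (hHH₁ hgH)).1 (mem_coe.2 (mem_of_mem_erase hfx)) (mem_coe.2 hu) hxu)).elim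
    have hlarge := mul_lt_degree_erase hm (hHG _ hgH).1 hgcard (hsort _ (hHH₁ hgH))
      (hHG _ hgH).2 hu
    rw [hur, hχu] at hlarge
    have hsum := mul_sum_filter_le _ hmono (κ (v i))
    have hS : ∑ k ∈ univ.filter (· ≤ κ (v i)), (L.filter fun j => κ (v j) = k).card =
        (L.filter fun j => κ (v j) ≤ κ (v i)).card := by
      rw [card_eq_sum_card_fiberwise (f := fun j => κ (v j)) (t := univ.filter (· ≤ κ (v i)))
        fun j hj => by simpa using (mem_filter.1 hj).2]
      refine sum_congr rfl fun k hk => ?_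
      rw [filter_filter]
      congr 1
      refine filter_congr fun j _ => ⟨fun h => ⟨h ▸ (mem_filter.1 hk).2, h⟩, And.right⟩
    have hA : ∑ k, (L.filter fun j => κ (v j) = k).card = s - p := by
      rw [← card_eq_sum_card_fiberwise fun j _ => by simp, Nat.card_Ico]
    rw [hS, hA] at hsum
    set S := (L.filter fun j => κ (v j) ≤ κ (v i)).card
    set d := degree G (((e i).erase (v i)).image f)
    set k : ℕ := (κ (v i) : ℕ)
    have hbound : (S : ℝ) + (p - 1) < d := by
      have hsum' : (r : ℝ) * S ≤ (k + 1) * (s - p) := by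
        have : ((s - p : ℕ) : ℝ) = (s : ℝ) - p := by push_cast [hps]; rfl
        rw [← this]
        exact_mod_cast hsum
      have hrm : (r : ℝ) * m = (s - 1) + (r - 1) * (c - 1) := by
        rw [hm_def]
        field_simp
      have h1 : (r : ℝ) * ((k + 1) * m) = (k + 1) * (s - p) + (k + 1) * ((p - 1) + (r - 1) * (c - 1)) := by
        linear_combination (k + 1 : ℝ) * hrm
      have h2 : (r : ℝ) * (p - 1) ≤ (p - 1) + (r - 1) * (c - 1) := by
        nlinarith
      have h3 : (0 : ℝ) ≤ (p - 1) + (r - 1) * (c - 1) := by nlinarith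
      have h4 : (0 : ℝ) ≤ k * ((p - 1) + (r - 1) * (c - 1)) := mul_nonneg (Nat.cast_nonneg _) h3
      have h5 : (r : ℝ) * (S + (p - 1)) ≤ r * ((k + 1) * m) := by linarith
      exact (le_of_mul_le_mul_left h5 (by linarith)).trans_lt hlarge
    have hbound' : S + p ≤ d := by
      have : ((S + p : ℕ) : ℝ) < ((d + 1 : ℕ) : ℝ) := by push_cast; linarith
      have := Nat.cast_lt.1 this
      omega
    change S ≤ (univ.filter _).card
    omega
  -- Hall's theorem embeds the leaves.
  obtain ⟨ℓ, hℓinj, hℓ⟩ := (all_card_le_biUnion_card_iff_exists_injective fun i : L => N i).1 (by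
    intro S
    rcases S.eq_empty_or_nonempty with rfl | hS
    · simp
    obtain ⟨i, hiS, hi⟩ := S.exists_max_image (fun i => κ (v i)) hS
    refine le_trans ?_ ((hN i i.2).trans (card_le_card (subset_biUnion_of_mem (fun i : L => N i) hiS)))
    rw [← card_map (Function.Embedding.subtype _)]
    refine card_le_card fun j hj => ?_
    obtain ⟨j, hjS, rfl⟩ := mem_map.1 hj
    exact mem_filter.2 ⟨j.2, hi j hjS⟩)
  have hvinj : Set.InjOn v L := by
    have key : ∀ i ∈ L, ∀ j ∈ L, j < i → v i ≠ v j := by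
      intro i hi j hj hji h
      rw [mem_Ico] at hi hj
      exact (hv i (by omega) hi.2).2.1 j hji (h ▸ (hv j (by omega) hj.2).1)
    intro i hi j hj hij
    rcases lt_trichotomy i j with h | h | h
    · exact (key j hj i hi h hij.symm).elim
    · exact h
    · exact (key i hi j hj h hij).elim
  obtain ⟨F, hFU, hFL⟩ : ∃ F : V → W, (∀ x ∈ U, F x = f x) ∧ ∀ i : L, F (v i) = ℓ i := by
    classical
    refine ⟨fun x => if h : ∃ i : L, v i = x then ℓ h.choose else f x, fun x hx => ?_, fun i => ?_⟩
    · refine dif_neg ?_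
      rintro ⟨i, rfl⟩
      exact hvU i i.2 hx
    · have h : ∃ j : L, v j = v i := ⟨i, rfl⟩
      exact (dif_pos h).trans (congrArg ℓ (Subtype.ext (hvinj h.choose.2 i.2 h.choose_spec)))
  have hℓN : ∀ i : L, ℓ i ∉ U.image f ∧ insert (ℓ i) (((e i).erase (v i)).image f) ∈ G :=
    fun i => (mem_filter.1 (hℓ i)).2
  have hcover : ∀ x ∈ ((range s).image e).biUnion id, x ∈ U ∨ ∃ i : L, v i = x := by
    intro x hx
    simp only [image_biUnion, mem_biUnion, mem_range, id] at hx
    obtain ⟨i, his, hxi⟩ := hx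
    rcases lt_or_ge i p with hip | hip
    · exact Or.inl (mem_biUnion.2 ⟨i, mem_range.2 hip, hxi⟩)
    by_cases hxv : x = v i
    · exact Or.inr ⟨⟨i, mem_Ico.2 ⟨hip, his⟩⟩, hxv.symm⟩
    obtain ⟨j, hj, hsub⟩ := htrunk i hip his
    exact Or.inl (mem_biUnion.2 ⟨j, mem_range.2 hj, hsub (mem_erase.2 ⟨hxv, hxi⟩)⟩)
  refine ⟨F, fun x hx y hy hxy => ?_, fun g hg => ?_⟩
  · rcases hcover x hx with hxU | ⟨i, rfl⟩ <;> rcases hcover y hy with hyU | ⟨j, rfl⟩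
    · rw [hFU x hxU, hFU y hyU] at hxy
      exact hf hxU hyU hxy
    · rw [hFU x hxU, hFL j] at hxy
      exact ((hℓN j).1 (hxy ▸ mem_image_of_mem f hxU)).elim
    · rw [hFL i, hFU y hyU] at hxy
      exact ((hℓN i).1 (hxy ▸ mem_image_of_mem f hyU)).elim
    · rw [hFL i, hFL j] at hxy
      rw [hℓinj hxy]
  · obtain ⟨i, his, rfl⟩ := mem_image.1 hg
    rw [mem_range] at his
    rcases lt_or_ge i p with hip | hip
    · rw [image_congr (g := f) fun x hx => hFU x (mem_biUnion.2 ⟨i, mem_range.2 hip, hx⟩)]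
      exact (hHG _ (hfH i hip)).1
    · obtain ⟨j, hj, hsub⟩ := htrunk i hip his
      have hD : ((e i).erase (v i)).image F = ((e i).erase (v i)).image f :=
        image_congr fun x hx => hFU x (mem_biUnion.2 ⟨j, mem_range.2 hj, hsub hx⟩)
      have hi : i ∈ L := mem_Ico.2 ⟨hip, his⟩
      rw [← insert_erase (hv i (by omega) his).1, image_insert, hD, hFL ⟨i, hi⟩]
      exact (hℓN ⟨i, hi⟩).2
end

section
/- Let q be a nonnegative real number and let G be an r-graph with e(G) > q·|∂(G)|. Then G contains a nonempty subgraph G′ (obtained by deleting edges) such that δ_{r−1}(G′) ≥ ⌊q⌋ + 1 and moreover e(G′) > q·|∂(G′)|. -/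
open Finset

variable {V : Type*}

/-- a sparse `r`-graph has a nonempty subgraph of large minimum `(r-1)`-degree,
which moreover still has many edges compared to its shadow. -/
theorem stmt6 {V : Type*} [DecidableEq V] (r : ℕ) (q : ℝ) (hq : 0 ≤ q)
    (G : Finset (Finset V)) (hG : ∀ g ∈ G, g.card = r)
    (hsize : q * ((hshadow G r).card : ℝ) < (G.card : ℝ)) :
    ∃ G' ⊆ G, G'.Nonempty ∧ (∀ D ∈ hshadow G' r, ⌊q⌋₊ + 1 ≤ degree G' D) ∧
      q * ((hshadow G' r).card : ℝ) < (G'.card : ℝ) := by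
  induction G using Finset.strongInduction with
  | H G ih =>
    by_cases h : ∀ D ∈ hshadow G r, ⌊q⌋₊ + 1 ≤ degree G D
    · refine ⟨G, Subset.rfl, ?_, h, hsize⟩
      rw [← Finset.card_pos, ← Nat.cast_pos (α := ℝ)]
      exact lt_of_le_of_lt (by positivity) hsize
    · push Not at h
      obtain ⟨D, hD, hdeg⟩ := h
      obtain ⟨e, he, hDe⟩ := Finset.mem_biUnion.mp hD
      have hsub : (G.filter fun e => ¬ D ⊆ e) ⊂ G :=
        Finset.filter_ssubset.mpr ⟨e, he, not_not.mpr (Finset.mem_powersetCard.mp hDe).1⟩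
      have hshadow_lt : (hshadow (G.filter fun e => ¬ D ⊆ e) r).card + 1 ≤ (hshadow G r).card := by
        refine Finset.card_lt_card (Finset.ssubset_iff_subset_ne.mpr
          ⟨Finset.biUnion_subset_biUnion_of_subset_left _ hsub.1, fun heq => ?_⟩)
        rw [← heq] at hD
        obtain ⟨f, hf, hDf⟩ := Finset.mem_biUnion.mp hD
        exact (Finset.mem_filter.mp hf).2 (Finset.mem_powersetCard.mp hDf).1
      have hcard : degree G D + (G.filter fun e => ¬ D ⊆ e).card = G.card :=
        Finset.card_filter_add_card_filter_not _
      have hdeg_le : (degree G D : ℝ) ≤ q :=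
        (Nat.cast_le.mpr (Nat.lt_succ_iff.mp hdeg)).trans (Nat.floor_le hq)
      have hsize' : q * ((hshadow (G.filter fun e => ¬ D ⊆ e) r).card : ℝ) <
          ((G.filter fun e => ¬ D ⊆ e).card : ℝ) := by
        have hmul := mul_le_mul_of_nonneg_left (Nat.cast_le (α := ℝ).mpr hshadow_lt) hq
        have hcard_real := congrArg (Nat.cast (R := ℝ)) hcard
        push_cast at hmul hcard_real
        linarith
      obtain ⟨G', hG', hrest⟩ := ih _ hsub (fun g hg => hG g (hsub.1 hg)) hsize'
      exact ⟨G', hG'.trans hsub.1, hrest⟩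
end
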